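/- arXiv:2605.10802 — 14 statements merged into one kernel-verified Lean document; each statement's English description precedes it below -/
import Mathlib

section
/- Let M be a Fisher market with a distinguished good ref and a distinguished buyer b_ref whose budget is e_{b_ref} = 1 and whose utility satisfies u_{b_ref,ref}(y) = y and u_{b_ref,j} ≡ 0 for every good j ≠ ref. Suppose the total budget of all other buyers satisfies Σ_{i ∈ B, i ≠ b_ref} e_i ≤ 2/5. Then for every ε with 0 ≤ ε < 1/11, every ε-approximate market equilibrium (p, x) of M satisfies 1/2 ≤ p_ref ≤ 2. -/
open Finset

/-- A Fisher market: finitely many divisible goods `G` (one unit of each),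
finitely many buyers `B`, positive budgets, and SPLC utilities.  Each per-good
utility `util i j` is, on `[0, ∞)`, a minimum of finitely many affine functions
(equivalently: continuous, piecewise-linear with finitely many pieces, and
concave), is non-decreasing on `[0, ∞)`, and vanishes at `0`. -/
structure FisherMarket (G B : Type) [Fintype G] [Fintype B] where
  budget : B → ℝ
  budget_pos : ∀ i, 0 < budget i
  util : B → G → ℝ → ℝ
  util_zero : ∀ i j, util i j 0 = 0
  util_mono : ∀ i j, MonotoneOn (util i j) (Set.Ici 0)
  util_pl : ∀ i j, ∃ S : Finset (ℝ × ℝ), ∃ hS : S.Nonempty,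
      ∀ y ∈ Set.Ici (0 : ℝ), util i j y = S.inf' hS fun mb => mb.1 * y + mb.2

namespace FisherMarket

variable {G B : Type} [Fintype G] [Fintype B]

/-- Total SPLC utility of buyer `i` at bundle `x`. -/
def totalUtil (M : FisherMarket G B) (i : B) (x : G → ℝ) : ℝ :=
  ∑ j, M.util i j (x j)

/-- `x` is a feasible bundle for buyer `i` at prices `p`. -/
def Feasible (M : FisherMarket G B) (p : G → ℝ) (i : B) (x : G → ℝ) : Prop :=
  (∀ j, 0 ≤ x j) ∧ ∑ j, p j * x j ≤ M.budget i

/-- `x` is an optimal bundle for buyer `i` at prices `p`, i.e. `x ∈ opt_i(p)`. -/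
def IsOptimal (M : FisherMarket G B) (p : G → ℝ) (i : B) (x : G → ℝ) : Prop :=
  M.Feasible p i x ∧ ∀ y, M.Feasible p i y → M.totalUtil i y ≤ M.totalUtil i x

/-- `(p, x)` is an `ε`-approximate market equilibrium of the Fisher market. -/
def IsApproxEquilibrium (M : FisherMarket G B) (ε : ℝ) (p : G → ℝ)
    (x : B → G → ℝ) : Prop :=
  (∀ j, 0 ≤ p j) ∧ (∀ i, M.IsOptimal p i (x i)) ∧ ∀ j, |(∑ i, x i j) - 1| ≤ ε

end FisherMarket

namespace FisherMarket

variable {G B : Type} [Fintype G] [Fintype B]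

/-- At nonnegative prices, the spending of a buyer on a single good is at most their budget. -/
theorem Feasible.spending_le {M : FisherMarket G B} {p : G → ℝ} {i : B} {x : G → ℝ}
    (hx : M.Feasible p i x) (hp : ∀ j, 0 ≤ p j) (j : G) : p j * x j ≤ M.budget i :=
  (Finset.single_le_sum (f := fun k => p k * x k) (fun k _ => mul_nonneg (hp k) (hx.1 k))
    (Finset.mem_univ j)).trans hx.2

/-- A buyer who values only the good `j`, linearly, has total utility equal to the amount of `j`. -/
theorem totalUtil_eq_of_single_good {M : FisherMarket G B} {i : B} {j : G}
    (hj : ∀ y ∈ Set.Ici (0 : ℝ), M.util i j y = y)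
    (hother : ∀ k, k ≠ j → ∀ y ∈ Set.Ici (0 : ℝ), M.util i k y = 0)
    {z : G → ℝ} (hz : ∀ k, 0 ≤ z k) : M.totalUtil i z = z j := by
  rw [totalUtil, Fintype.sum_eq_single j fun k hk => hother k hk _ (hz k), hj _ (hz j)]

/-- A buyer who values only the good `j`, linearly, demands at least any affordable amount
of `j`. -/
theorem IsOptimal.le_of_affordable {M : FisherMarket G B} {p : G → ℝ} {i : B} {j : G}
    {x : G → ℝ} (hx : M.IsOptimal p i x)
    (hj : ∀ y ∈ Set.Ici (0 : ℝ), M.util i j y = y)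
    (hother : ∀ k, k ≠ j → ∀ y ∈ Set.Ici (0 : ℝ), M.util i k y = 0)
    {t : ℝ} (ht : 0 ≤ t) (hpt : p j * t ≤ M.budget i) : t ≤ x j := by
  classical
  have hz : ∀ k, 0 ≤ (Pi.single j t : G → ℝ) k := fun k => (Pi.single_nonneg.2 ht : (0 : G → ℝ) ≤ Pi.single j t) k
  have hfeas : M.Feasible p i (Pi.single j t) := by
    refine ⟨hz, ?_⟩
    rw [Fintype.sum_eq_single j fun k hk => by rw [Pi.single_eq_of_ne hk, mul_zero]]
    simpa using hpt
  have h := hx.2 _ hfeas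
  rwa [totalUtil_eq_of_single_good hj hother hz,
    totalUtil_eq_of_single_good hj hother hx.1.1, Pi.single_eq_same] at h

end FisherMarket

/-- with a reference buyer of budget 1 interested only in the
reference good, and all other budgets summing to at most 2/5, every
ε-approximate equilibrium (0 ≤ ε < 1/11) has 1/2 ≤ p_ref ≤ 2. -/
theorem stmt_2 {G B : Type} [Fintype G] [Fintype B] [DecidableEq B]
    (M : FisherMarket G B) (ref : G) (bref : B)
    (hbudget : M.budget bref = 1)
    (huref : ∀ y ∈ Set.Ici (0 : ℝ), M.util bref ref y = y)
    (huother : ∀ j, j ≠ ref → ∀ y ∈ Set.Ici (0 : ℝ), M.util bref j y = 0)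
    (hothers : ∑ i ∈ Finset.univ.erase bref, M.budget i ≤ 2 / 5)
    (ε : ℝ) (hε0 : 0 ≤ ε) (hε1 : ε < 1 / 11)
    (p : G → ℝ) (x : B → G → ℝ) (heq : M.IsApproxEquilibrium ε p x) :
    1 / 2 ≤ p ref ∧ p ref ≤ 2 := by
  obtain ⟨hp, hopt, hclear⟩ := heq
  obtain ⟨hlow, hhigh⟩ := abs_le.1 (hclear ref)
  constructor
  · by_contra! h
    have hdemand : 2 ≤ x bref ref :=
      (hopt bref).le_of_affordable huref huother (by norm_num) (by linarith)
    have hle : x bref ref ≤ ∑ i, x i ref :=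
      Finset.single_le_sum (f := fun i => x i ref) (fun i _ => (hopt i).1.1 ref)
        (Finset.mem_univ bref)
    linarith
  · have hspend : p ref * ∑ i, x i ref ≤ ∑ i, M.budget i := by
      rw [Finset.mul_sum]
      exact Finset.sum_le_sum fun i _ => (hopt i).1.spending_le hp ref
    rw [← Finset.add_sum_erase _ M.budget (Finset.mem_univ bref), hbudget] at hspend
    have hsupply : (10 / 11 : ℝ) ≤ ∑ i, x i ref := by linarith
    linarith [mul_le_mul_of_nonneg_left hsupply (hp ref)]
end

section
/- Let 0 ≤ ε < 1/11 and let (p, x) be an ε-approximate market equilibrium of a Fisher market. Let j be a good with p_j > 0 and let i be a buyer. Suppose that every buyer i' ≠ i has a real c_{i'} ≥ 0 such that u_{i',j} is constant on [c_{i'}, ∞) and has some good with strictly increasing utility and strictly positive price, and suppose Σ_{i'≠i} c_{i'} ≤ 10/11. Then x_{i,j} ≥ 1 − ε − 10/11 > 0; in particular, buyer i is allocated a strictly positive amount of good j. -/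
open Finset

namespace FisherMarket

/-- An optimal bundle contains no more of a positively priced good than its satiation level, as long
as the buyer strictly values some positively priced good. -/
theorem IsOptimal.le_of_satiated {G B : Type} [Fintype G] [Fintype B] {M : FisherMarket G B}
    {p : G → ℝ} {i : B} {x : G → ℝ} (hx : M.IsOptimal p i x) {j j' : G} (hpj : 0 < p j)
    (hpj' : 0 < p j') (hmono : StrictMonoOn (M.util i j') (Set.Ici 0)) {c : ℝ} (hc : 0 ≤ c)
    (hsat : ∀ y, c ≤ y → M.util i j y = M.util i j c) : x j ≤ c := by
  classical
  by_contra! hlt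
  have hne : j' ≠ j := by
    rintro rfl
    exact (hmono hc (hc.trans hlt.le) hlt).ne' (hsat _ hlt.le)
  obtain ⟨⟨hnonneg, hbudget⟩, hopt⟩ := hx
  set d : ℝ := p j * (x j - c) / p j' with hd
  have hdpos : 0 < d := div_pos (mul_pos hpj (sub_pos.2 hlt)) hpj'
  let y : G → ℝ := fun k ↦ x k + (if k = j then c - x j else 0) + (if k = j' then d else 0)
  have hyj : y j = c := by simp [y, hne.symm]
  have hyj' : y j' = x j' + d := by simp [y, hne]
  have hyk : ∀ k, k ≠ j → k ≠ j' → y k = x k := fun k h h' ↦ by simp [y, h, h']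
  have hy : M.Feasible p i y := by
    refine ⟨fun k ↦ ?_, ?_⟩
    · by_cases h : k = j
      · rw [h, hyj]; exact hc
      · by_cases h' : k = j'
        · rw [h', hyj']; exact add_nonneg (hnonneg j') hdpos.le
        · rw [hyk k h h']; exact hnonneg k
    · have hcost : ∑ k, p k * y k = ∑ k, p k * x k + p j * (c - x j) + p j' * d := by
        simp [y, mul_add, Finset.sum_add_distrib]
      have hd' : p j' * d = p j * (x j - c) := by rw [hd]; field_simp
      linarith
  have hutil : M.totalUtil i x < M.totalUtil i y := by
    refine Finset.sum_lt_sum (fun k _ ↦ ?_) ⟨j', Finset.mem_univ _, ?_⟩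
    · by_cases h : k = j
      · rw [h, hyj, hsat _ hlt.le]
      · by_cases h' : k = j'
        · rw [h', hyj']
          exact M.util_mono i j' (hnonneg j') (add_nonneg (hnonneg j') hdpos.le) (by linarith)
        · rw [hyk k h h']
    · rw [hyj']
      exact hmono (hnonneg j') (add_nonneg (hnonneg j') hdpos.le) (by linarith)
  exact (hopt y hy).not_gt hutil

end FisherMarket

/-- if every buyer other than `i` is satiated with good `j`
beyond `c i'`, with `∑_{i' ≠ i} c i' ≤ 10/11`, then at an ε-approximate
equilibrium (0 ≤ ε < 1/11) buyer `i` gets at least `1 - ε - 10/11 > 0`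
units of good `j`. -/
theorem stmt_3 {G B : Type} [Fintype G] [Fintype B] [DecidableEq B]
    (M : FisherMarket G B)
    (ε : ℝ) (hε0 : 0 ≤ ε) (hε1 : ε < 1 / 11)
    (p : G → ℝ) (x : B → G → ℝ) (heq : M.IsApproxEquilibrium ε p x)
    (j : G) (hpj : 0 < p j) (i : B)
    (c : B → ℝ)
    (hc : ∀ i', i' ≠ i → 0 ≤ c i' ∧
      (∀ y, c i' ≤ y → M.util i' j y = M.util i' j (c i')) ∧
      ∃ j', 0 < p j' ∧ StrictMonoOn (M.util i' j') (Set.Ici 0))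
    (hsum : ∑ i' ∈ Finset.univ.erase i, c i' ≤ 10 / 11) :
    1 - ε - 10 / 11 ≤ x i j ∧ 0 < x i j := by
  obtain ⟨-, hopt, hclear⟩ := heq
  have hle : ∑ i' ∈ Finset.univ.erase i, x i' j ≤ ∑ i' ∈ Finset.univ.erase i, c i' := by
    refine Finset.sum_le_sum fun i' hi' ↦ ?_
    obtain ⟨hc0, hsat, j', hpj', hmono⟩ := hc i' (Finset.ne_of_mem_erase hi')
    exact (hopt i').le_of_satiated hpj hpj' hmono hc0 hsat
  have hsplit := Finset.add_sum_erase Finset.univ (fun i' ↦ x i' j) (Finset.mem_univ i)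
  have hlow := (abs_le.1 (hclear j)).1
  constructor <;> linarith
end

section
/- In the gadget setting, let j be a good with 0 < p_j ≤ H and let i be the auxiliary buyer aux(j, r) for some r ∈ [0, 1]. Then every optimal bundle x_i ∈ opt_i(p) satisfies x_{i,j} = r. -/
open Finset

variable {G B : Type} [Fintype G] [Fintype B]

/-- Buyer `i` is a NOT-inverter with input good `gin` and output good `gout`:
its budget is `t * Hlow` and its utility is
`a * min x_gin t + s * x_gout + x_ref` (zero for all other goods). -/
def IsNotInverter (M : FisherMarket G B) (s a t Hlow : ℝ) (ref gin gout : G)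
    (i : B) : Prop :=
  gin ≠ gout ∧ gin ≠ ref ∧ gout ≠ ref ∧
  M.budget i = t * Hlow ∧
  (∀ y ∈ Set.Ici (0 : ℝ), M.util i gin y = a * min y t) ∧
  (∀ y ∈ Set.Ici (0 : ℝ), M.util i gout y = s * y) ∧
  (∀ y ∈ Set.Ici (0 : ℝ), M.util i ref y = y) ∧
  ∀ j, j ≠ gin → j ≠ gout → j ≠ ref → ∀ y ∈ Set.Ici (0 : ℝ), M.util i j y = 0

/-- Buyer `i` is a NAND-inverter with input goods `gin1, gin2` and output good
`gout`: its budget is `2 * t * Hlow` and its utility is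
`a * min x_gin1 t + a * min x_gin2 t + s * x_gout + x_ref`
(zero for all other goods). -/
def IsNandInverter (M : FisherMarket G B) (s a t Hlow : ℝ)
    (ref gin1 gin2 gout : G) (i : B) : Prop :=
  gin1 ≠ gin2 ∧ gin1 ≠ gout ∧ gin2 ≠ gout ∧
  gin1 ≠ ref ∧ gin2 ≠ ref ∧ gout ≠ ref ∧
  M.budget i = 2 * t * Hlow ∧
  (∀ y ∈ Set.Ici (0 : ℝ), M.util i gin1 y = a * min y t) ∧
  (∀ y ∈ Set.Ici (0 : ℝ), M.util i gin2 y = a * min y t) ∧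
  (∀ y ∈ Set.Ici (0 : ℝ), M.util i gout y = s * y) ∧
  (∀ y ∈ Set.Ici (0 : ℝ), M.util i ref y = y) ∧
  ∀ j, j ≠ gin1 → j ≠ gin2 → j ≠ gout → j ≠ ref →
    ∀ y ∈ Set.Ici (0 : ℝ), M.util i j y = 0

/-- Buyer `i` is the auxiliary buyer `aux(j, r)`: its budget is `r * Hhigh`
and its utility is `2 * s * min x_j r + x_ref` (zero for all other goods). -/
def IsAuxBuyer (M : FisherMarket G B) (s Hhigh : ℝ) (ref j : G) (r : ℝ)
    (i : B) : Prop :=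
  j ≠ ref ∧ 0 ≤ r ∧ r ≤ 1 ∧
  M.budget i = r * Hhigh ∧
  (∀ y ∈ Set.Ici (0 : ℝ), M.util i j y = 2 * s * min y r) ∧
  (∀ y ∈ Set.Ici (0 : ℝ), M.util i ref y = y) ∧
  ∀ j', j' ≠ j → j' ≠ ref → ∀ y ∈ Set.Ici (0 : ℝ), M.util i j' y = 0

/-- The utility of an auxiliary buyer only depends on its good and on the reference good. -/
theorem IsAuxBuyer.totalUtil_eq {M : FisherMarket G B} {s Hhigh r : ℝ} {ref j : G} {i : B}
    (h : IsAuxBuyer M s Hhigh ref j r i) {x : G → ℝ} (hx : ∀ g, 0 ≤ x g) :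
    M.totalUtil i x = 2 * s * min (x j) r + x ref := by
  obtain ⟨hne, -, -, -, hj, href, hother⟩ := h
  rw [FisherMarket.totalUtil, Fintype.sum_eq_add j ref hne
    fun g hg => hother g hg.1 hg.2 _ (hx g), hj _ (hx j), href _ (hx ref)]

/-- Any two distinct goods of a feasible bundle together cost at most the budget. -/
theorem FisherMarket.Feasible.add_le_budget {M : FisherMarket G B} {p x : G → ℝ} {i : B}
    (h : M.Feasible p i x) (hp : ∀ g, 0 ≤ p g) {g g' : G} (hne : g ≠ g') :
    p g * x g + p g' * x g' ≤ M.budget i := by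
  classical
  rw [← Finset.sum_pair (f := fun g => p g * x g) hne]
  exact (Finset.sum_le_univ_sum_of_nonneg fun g => mul_nonneg (hp g) (h.1 g)).trans h.2

/-- A bundle of two goods is feasible when it is nonnegative and within the budget. -/
theorem FisherMarket.exists_feasible_pair (M : FisherMarket G B) {p : G → ℝ} {i : B} {g g' : G}
    (hne : g ≠ g') {u v : ℝ} (hu : 0 ≤ u) (hv : 0 ≤ v)
    (hbudget : p g * u + p g' * v ≤ M.budget i) :
    ∃ y : G → ℝ, M.Feasible p i y ∧ y g = u ∧ y g' = v := by
  classical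
  refine ⟨Pi.single g u + Pi.single g' v, ⟨fun h => ?_, ?_⟩, ?_, ?_⟩
  · have hgu : 0 ≤ (Pi.single g u : G → ℝ) := Pi.single_nonneg.2 hu
    have hgv : 0 ≤ (Pi.single g' v : G → ℝ) := Pi.single_nonneg.2 hv
    exact add_nonneg (hgu h) (hgv h)
  · simpa [mul_add, Finset.sum_add_distrib, Pi.single_apply] using hbudget
  · simp [hne]
  · simp [hne.symm]

/-- in the gadget setting, the auxiliary buyer `aux(j, r)` buys
exactly `r` units of good `j` in every optimal bundle, provided `0 < p_j ≤ H`. -/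
theorem stmt_5 {G B : Type} [Fintype G] [Fintype B]
    (M : FisherMarket G B) (p : G → ℝ) (hp : ∀ j, 0 ≤ p j)
    (s a t k H Hlow Hhigh : ℝ)
    (hs : 0 < s) (hsa : s < a) (ha : 1 ≤ a)
    (ht0 : 0 < t) (ht2 : t ≤ 1 / 2)
    (hk : 110 < k) (hsk : s ≤ 1 / (20 * k))
    (hHlow0 : 0 < Hlow) (hHlowH : Hlow ≤ H) (hHhigh : H ≤ Hhigh)
    (hratio : 1 - 4 / k ≤ Hlow / Hhigh)
    (ref : G) (href : p ref = H / s)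
    (j : G) (hpj0 : 0 < p j) (hpjH : p j ≤ H)
    (r : ℝ) (i : B) (haux : IsAuxBuyer M s Hhigh ref j r i)
    (x : G → ℝ) (hx : M.IsOptimal p i x) :
    x j = r := by
  have hne := haux.1
  have hr : 0 ≤ r := haux.2.1
  have hb : M.budget i = r * Hhigh := haux.2.2.2.1
  have hH : 0 < H := hHlow0.trans_le hHlowH
  have hspend := hx.1.add_le_budget hp hne
  rw [hb, href] at hspend
  have hsave : 0 ≤ r * (Hhigh - p j) := mul_nonneg hr (by linarith)
  obtain ⟨y, hy, hyj, hyref⟩ := M.exists_feasible_pair (p := p) (i := i) hne hr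
    (v := s * (r * (Hhigh - p j)) / H) (by positivity)
    (by rw [hb, href]; field_simp; linarith)
  have hopt := hx.2 y hy
  rw [haux.totalUtil_eq hy.1, haux.totalUtil_eq hx.1.1, hyj, hyref, min_self] at hopt
  have hxref : x ref ≤ s * (r * Hhigh - p j * x j) / H := by
    rw [le_div_iff₀ hH]
    have := mul_le_mul_of_nonneg_left hspend hs.le
    field_simp at this
    linarith
  have hgain : 2 * (r - min (x j) r) * H ≤ p j * (r - x j) := by
    have hchain : 2 * s * r + s * (r * (Hhigh - p j)) / H
        ≤ 2 * s * min (x j) r + s * (r * Hhigh - p j * x j) / H := by linarith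
    field_simp at hchain
    linarith
  rcases lt_trichotomy (x j) r with hlt | heq | hgt
  · rw [min_eq_left hlt.le] at hgain
    nlinarith
  · exact heq
  · rw [min_eq_right hgt.le] at hgain
    nlinarith
end

section
/- In the gadget setting, suppose p_out > L. (a) If i is a NOT-inverter with input good in and output good out and 0 < p_in ≤ H, then every x_i ∈ opt_i(p) with x_{i,out} > 0 or x_{i,ref} > 0 satisfies x_{i,in} = t. (b) If i is a NAND-inverter with input goods in1, in2 and output good out and 0 < p_in1 ≤ H, 0 < p_in2 ≤ H, then every x_i ∈ opt_i(p) with x_{i,out} > 0 or x_{i,ref} > 0 satisfies x_{i,in1} = t and x_{i,in2} = t. -/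
open Finset

variable {G B : Type} [Fintype G] [Fintype B]

open Classical in
/-- Changing two entries of a tuple changes a separable sum by the change of the two terms. -/
lemma sum_update_update_sub_sum {ι : Type*} [Fintype ι] (f : ι → ℝ → ℝ) (x : ι → ℝ) {j l : ι}
    (hjl : j ≠ l) (u v : ℝ) :
    ∑ m, f m (Function.update (Function.update x j u) l v m) - ∑ m, f m (x m) =
      (f j u - f j (x j)) + (f l v - f l (x l)) := by
  rw [← Finset.sum_sub_distrib, Finset.sum_eq_add j l hjl]
  · simp [hjl]
  · rintro m - ⟨hmj, hml⟩
    simp [hmj, hml]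
  · simp
  · simp

namespace FisherMarket

/-- Reallocating the money spent on two goods between them does not improve an optimal bundle. -/
lemma IsOptimal.util_add_util_le {M : FisherMarket G B} {p : G → ℝ} {i : B} {x : G → ℝ}
    (hx : M.IsOptimal p i x) {j l : G} (hjl : j ≠ l) {u v : ℝ} (hu : 0 ≤ u) (hv : 0 ≤ v)
    (hcost : p j * u + p l * v = p j * x j + p l * x l) :
    M.util i j u + M.util i l v ≤ M.util i j (x j) + M.util i l (x l) := by
  classical
  obtain ⟨⟨hnonneg, hbudget⟩, hopt⟩ := hx
  have hfeas : M.Feasible p i (Function.update (Function.update x j u) l v) := by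
    refine ⟨fun m => ?_, ?_⟩
    · simp only [Function.update_apply]
      split_ifs
      exacts [hv, hu, hnonneg m]
    · have h := sum_update_update_sub_sum (fun m y => p m * y) x hjl u v
      linarith
  have hle := hopt _ hfeas
  have h := sum_update_update_sub_sum (M.util i) x hjl u v
  unfold totalUtil at hle
  linarith

/-- If good `j` has utility `a * min y t` and, below the cap `t`, a strictly larger bang per buck
than good `l` with linear utility `c * y`, then an optimal bundle that contains some of good `l`
contains exactly `t` of good `j`. -/
lemma IsOptimal.eq_cap {M : FisherMarket G B} {p : G → ℝ} {i : B} {x : G → ℝ}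
    (hx : M.IsOptimal p i x) {j l : G} (hjl : j ≠ l) {a c t : ℝ} (hc : 0 < c) (ht : 0 ≤ t)
    (hj : ∀ y ∈ Set.Ici (0 : ℝ), M.util i j y = a * min y t)
    (hl : ∀ y ∈ Set.Ici (0 : ℝ), M.util i l y = c * y)
    (hpj : 0 < p j) (hpl : 0 < p l) (hbang : c * p j < a * p l) (hxl : 0 < x l) :
    x j = t := by
  have hxj : 0 ≤ x j := hx.1.1 j
  rcases lt_trichotomy (x j) t with hlt | heq | hgt
  · obtain ⟨δ, hδ, hδt, hδl⟩ : ∃ δ : ℝ, 0 < δ ∧ δ * p l ≤ t - x j ∧ δ * p j ≤ x l :=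
      ⟨min ((t - x j) / p l) (x l / p j),
        lt_min (div_pos (sub_pos.2 hlt) hpl) (div_pos hxl hpj),
        (le_div_iff₀ hpl).1 (min_le_left _ _), (le_div_iff₀ hpj).1 (min_le_right _ _)⟩
    have hu : 0 ≤ x j + δ * p l := by positivity
    have hv : 0 ≤ x l - δ * p j := sub_nonneg.2 hδl
    have h := hx.util_add_util_le hjl hu hv (by ring)
    rw [hj _ hu, hl _ hv, hj _ hxj, hl _ hxl.le, min_eq_left (by linarith),
      min_eq_left hlt.le] at h
    nlinarith [mul_lt_mul_of_pos_left hbang hδ]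
  · exact heq
  · have hgain : 0 < p j * (x j - t) / p l := div_pos (mul_pos hpj (sub_pos.2 hgt)) hpl
    have hv : 0 ≤ x l + p j * (x j - t) / p l := by positivity
    have h := hx.util_add_util_le hjl ht hv (by field_simp; ring)
    rw [hj _ ht, hl _ hv, hj _ hxj, hl _ hxl.le, min_self, min_eq_right hgt.le] at h
    nlinarith [mul_pos hc hgain]

end FisherMarket

/-- in the gadget setting, if the output price exceeds
`L = s·H/a`, then (a) a NOT-inverter that buys a positive amount of its output
good or of the reference good has bought its full anti-endowment `t` of the
input good, and (b) likewise a NAND-inverter for both of its input goods. -/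
theorem stmt_6 {G B : Type} [Fintype G] [Fintype B]
    (M : FisherMarket G B) (p : G → ℝ) (hp : ∀ j, 0 ≤ p j)
    (s a t k H Hlow Hhigh : ℝ)
    (hs : 0 < s) (hsa : s < a) (ha : 1 ≤ a)
    (ht0 : 0 < t) (ht2 : t ≤ 1 / 2)
    (hk : 110 < k) (hsk : s ≤ 1 / (20 * k))
    (hHlow0 : 0 < Hlow) (hHlowH : Hlow ≤ H) (hHhigh : H ≤ Hhigh)
    (hratio : 1 - 4 / k ≤ Hlow / Hhigh)
    (ref : G) (href : p ref = H / s) :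
    (∀ (gin gout : G) (i : B), IsNotInverter M s a t Hlow ref gin gout i →
      s * H / a < p gout → 0 < p gin → p gin ≤ H →
      ∀ x, M.IsOptimal p i x → (0 < x gout ∨ 0 < x ref) → x gin = t) ∧
    (∀ (gin1 gin2 gout : G) (i : B),
      IsNandInverter M s a t Hlow ref gin1 gin2 gout i →
      s * H / a < p gout → 0 < p gin1 → p gin1 ≤ H → 0 < p gin2 → p gin2 ≤ H →
      ∀ x, M.IsOptimal p i x → (0 < x gout ∨ 0 < x ref) →
        x gin1 = t ∧ x gin2 = t) := by
  have hH : 0 < H := hHlow0.trans_le hHlowH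
  have ha0 : 0 < a := one_pos.trans_le ha
  have hpref : 0 < p ref := href ▸ div_pos hH hs
  have hcap : ∀ (gin gout : G) (i : B) (x : G → ℝ), gin ≠ gout → gin ≠ ref →
      (∀ y ∈ Set.Ici (0 : ℝ), M.util i gin y = a * min y t) →
      (∀ y ∈ Set.Ici (0 : ℝ), M.util i gout y = s * y) →
      (∀ y ∈ Set.Ici (0 : ℝ), M.util i ref y = y) →
      s * H / a < p gout → 0 < p gin → p gin ≤ H → M.IsOptimal p i x →
      (0 < x gout ∨ 0 < x ref) → x gin = t := by
    rintro gin gout i x hne hner huin huout huref hpout hpin hpinH hx (hxo | hxr)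
    · have hbang : s * p gin < a * p gout :=
        (mul_le_mul_of_nonneg_left hpinH hs.le).trans_lt ((div_lt_iff₀' ha0).1 hpout)
      exact hx.eq_cap hne hs ht0.le huin huout hpin ((by positivity : 0 < s * H / a).trans hpout)
        hbang hxo
    · have hbang : 1 * p gin < a * p ref := by
        rw [href, one_mul, ← mul_div_assoc, lt_div_iff₀ hs]
        nlinarith
      exact hx.eq_cap hner one_pos ht0.le huin (fun y hy => by rw [huref y hy, one_mul]) hpin
        hpref hbang hxr
  refine ⟨?_, ?_⟩
  · rintro gin gout i ⟨hne, hner, -, -, huin, huout, huref, -⟩ hpout hpin hpinH x hx hpos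
    exact hcap gin gout i x hne hner huin huout huref hpout hpin hpinH hx hpos
  · rintro gin1 gin2 gout i ⟨-, hne1, hne2, hner1, hner2, -, -, huin1, huin2, huout, huref, -⟩
      hpout hpin1 hpinH1 hpin2 hpinH2 x hx hpos
    exact ⟨hcap gin1 gout i x hne1 hner1 huin1 huout huref hpout hpin1 hpinH1 hx hpos,
      hcap gin2 gout i x hne2 hner2 huin2 huout huref hpout hpin2 hpinH2 hx hpos⟩
end

section
/- In the gadget setting, let 0 ≤ ε < 1/11 and let (p, x) be an ε-approximate market equilibrium. Let i be a NOT-inverter with input good in and output good out, and suppose 0 < p_in ≤ H, p_out > 0, and x_{i,out} > 0. Then t − 3/k ≤ x_{i,in} ≤ t. -/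
open Finset

variable {G B : Type} [Fintype G] [Fintype B]

/-- A sum of a function vanishing off three distinct points. -/
theorem sum_eq_three {ι : Type*} [Fintype ι] {f : ι → ℝ} {a b c : ι}
    (hab : a ≠ b) (hac : a ≠ c) (hbc : b ≠ c)
    (hf : ∀ j, j ≠ a → j ≠ b → j ≠ c → f j = 0) :
    ∑ j, f j = f a + f b + f c := by
  classical
  rw [← Finset.sum_subset (Finset.subset_univ {a, b, c})]
  · rw [Finset.sum_insert (by simp [hab, hac]), Finset.sum_pair hbc, add_assoc]
  · intro j _ hj
    simp only [Finset.mem_insert, Finset.mem_singleton, not_or] at hj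
    exact hf j hj.1 hj.2.1 hj.2.2

/-- A nonnegative sum dominates its terms at three distinct points. -/
theorem three_le_sum {ι : Type*} [Fintype ι] {f : ι → ℝ} {a b c : ι}
    (hab : a ≠ b) (hac : a ≠ c) (hbc : b ≠ c) (hf : ∀ j, 0 ≤ f j) :
    f a + f b + f c ≤ ∑ j, f j := by
  classical
  calc f a + f b + f c = ∑ j ∈ {a, b, c}, f j := by
        rw [Finset.sum_insert (by simp [hab, hac]), Finset.sum_pair hbc, add_assoc]
    _ ≤ ∑ j, f j :=
        Finset.sum_le_sum_of_subset_of_nonneg (Finset.subset_univ _) fun j _ _ => hf j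

/-- No buyer holds more of a good than the total allocated amount allows. -/
theorem FisherMarket.IsApproxEquilibrium.le_one_add {M : FisherMarket G B} {ε : ℝ} {p : G → ℝ}
    {x : B → G → ℝ} (h : M.IsApproxEquilibrium ε p x) (i : B) (j : G) :
    x i j ≤ 1 + ε := by
  have h₁ := Finset.single_le_sum (f := fun i => x i j)
    (fun i _ => (h.2.1 i).1.1 j) (Finset.mem_univ i)
  have h₂ := (abs_le.mp (h.2.2 j)).2
  linarith

/-- The amounts of the three relevant goods in an optimal bundle of a NOT-inverter solve the
utility maximization problem restricted to these goods. -/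
theorem IsNotInverter.utility_le {M : FisherMarket G B} {s a t Hlow : ℝ} {ref gin gout : G}
    {i : B} (hinv : IsNotInverter M s a t Hlow ref gin gout i) {p x : G → ℝ}
    (hx : M.IsOptimal p i x) {u v w : ℝ} (hu : 0 ≤ u) (hv : 0 ≤ v) (hw : 0 ≤ w)
    (hcost : p gin * u + p gout * v + p ref * w ≤ t * Hlow) :
    a * min u t + s * v + w ≤ a * min (x gin) t + s * x gout + x ref := by
  classical
  obtain ⟨h₁, h₂, h₃, hb, hin, hout, href, hother⟩ := hinv
  let y : G → ℝ := fun j => if j = gin then u else if j = gout then v else if j = ref then w else 0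
  have hyin : y gin = u := by simp [y]
  have hyout : y gout = v := by simp [y, h₁.symm]
  have hyref : y ref = w := by simp [y, h₂.symm, h₃.symm]
  have hy : ∀ j, 0 ≤ y j := by
    intro j
    simp only [y]
    split_ifs <;> first | assumption | exact le_rfl
  have hutil : ∀ z : G → ℝ, (∀ j, 0 ≤ z j) →
      M.totalUtil i z = a * min (z gin) t + s * z gout + z ref := by
    intro z hz
    rw [FisherMarket.totalUtil, sum_eq_three h₁ h₂ h₃ fun j ha hb hc => hother j ha hb hc _ (hz j),
      hin _ (hz _), hout _ (hz _), href _ (hz _)]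
  have hfeas : M.Feasible p i y := by
    refine ⟨hy, ?_⟩
    rw [sum_eq_three h₁ h₂ h₃ fun j ha hb hc => by simp [y, ha, hb, hc], hyin, hyout, hyref, hb]
    exact hcost
  have := hx.2 y hfeas
  rwa [hutil y hy, hutil x hx.1.1, hyin, hyout, hyref] at this

/-- The three relevant goods of a NOT-inverter cost at most its budget. -/
theorem IsNotInverter.cost_le {M : FisherMarket G B} {s a t Hlow : ℝ} {ref gin gout : G}
    {i : B} (hinv : IsNotInverter M s a t Hlow ref gin gout i) {p x : G → ℝ}
    (hp : ∀ j, 0 ≤ p j) (hx : M.IsOptimal p i x) :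
    p gin * x gin + p gout * x gout + p ref * x ref ≤ t * Hlow := by
  obtain ⟨h₁, h₂, h₃, hb, -⟩ := hinv
  rw [← hb]
  exact (three_le_sum (f := fun j => p j * x j) h₁ h₂ h₃
    fun j => mul_nonneg (hp j) (hx.1.1 j)).trans hx.1.2

/-- The inverter spends at least `t * Hlow` on input and output together, of which the output
accounts for little, so its input amount is close to `t`. -/
theorem input_lower_bound {ε s t k H Hlow Hhigh P Q u v : ℝ} (hε1 : ε < 1 / 11)
    (hs : 0 < s) (ht0 : 0 < t) (ht2 : t ≤ 1 / 2) (hk : 110 < k) (hsk : s ≤ 1 / (20 * k))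
    (hH : 0 < H) (hHhigh : H ≤ Hhigh) (hratio : 1 - 4 / k ≤ Hlow / Hhigh)
    (hP : P ≤ H) (hQ : Q ≤ s * H) (hu : 0 ≤ u) (hv : 0 ≤ v) (hv1 : v ≤ 1 + ε)
    (hspend : t * Hlow ≤ P * u + Q * v) :
    t - 3 / k ≤ u := by
  have hk0 : 0 < k := by linarith
  by_contra! hlow
  have hsk' : s ≤ 1 / k / 20 := by rw [div_div, mul_comm k]; exact hsk
  have hHl : (1 - 4 / k) * H ≤ Hlow := by
    have h4 : 4 / k ≤ 1 := by rw [div_le_one hk0]; linarith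
    have := (le_div_iff₀ (hH.trans_le hHhigh)).mp hratio
    exact (mul_le_mul_of_nonneg_left hHhigh (by linarith)).trans this
  have h3 : 3 / k = 3 * (1 / k) := by ring
  have h4 : 4 / k = 4 * (1 / k) := by ring
  rw [h3] at hlow
  rw [h4] at hHl
  have hq : 0 < 1 / k := by positivity
  generalize 1 / k = q at *
  have e₁ : Q * v ≤ s * H * (12 / 11) :=
    mul_le_mul hQ (by linarith) hv (by positivity)
  have e₂ : P * u ≤ H * (t - 3 * q) :=
    mul_le_mul hP hlow.le hu hH.le
  have e₃ : t * ((1 - 4 * q) * H) ≤ t * Hlow := mul_le_mul_of_nonneg_left hHl ht0.le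
  have e₄ : s * H ≤ q / 20 * H := mul_le_mul_of_nonneg_right hsk' hH.le
  have e₅ : t * (q * H) ≤ 1 / 2 * (q * H) := mul_le_mul_of_nonneg_right ht2 (by positivity)
  have e₆ := mul_pos hq hH
  linarith

/-- at an ε-approximate equilibrium (0 ≤ ε < 1/11), a NOT-inverter
with `0 < p_in ≤ H`, `p_out > 0`, buying a positive amount of its output good,
buys between `t - 3/k` and `t` units of its input good. -/
theorem stmt_7 {G B : Type} [Fintype G] [Fintype B]
    (M : FisherMarket G B) (ε : ℝ) (hε0 : 0 ≤ ε) (hε1 : ε < 1 / 11)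
    (p : G → ℝ) (x : B → G → ℝ) (heq : M.IsApproxEquilibrium ε p x)
    (s a t k H Hlow Hhigh : ℝ)
    (hs : 0 < s) (hsa : s < a) (ha : 1 ≤ a)
    (ht0 : 0 < t) (ht2 : t ≤ 1 / 2)
    (hk : 110 < k) (hsk : s ≤ 1 / (20 * k))
    (hHlow0 : 0 < Hlow) (hHlowH : Hlow ≤ H) (hHhigh : H ≤ Hhigh)
    (hratio : 1 - 4 / k ≤ Hlow / Hhigh)
    (ref : G) (href : p ref = H / s)
    (gin gout : G) (i : B) (hinv : IsNotInverter M s a t Hlow ref gin gout i)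
    (hpin0 : 0 < p gin) (hpinH : p gin ≤ H) (hpout : 0 < p gout)
    (hxout : 0 < x i gout) :
    t - 3 / k ≤ x i gin ∧ x i gin ≤ t := by
  have hx := heq.2.1 i
  have hmax := fun {u v w : ℝ} => hinv.utility_le hx (u := u) (v := v) (w := w)
  have hcost := hinv.cost_le heq.1 hx
  have hin0 := hx.1.1 gin
  have href0 := hx.1.1 ref
  have hout1 := heq.le_one_add i gout
  have hupper : x i gin ≤ t := by
    by_contra! h
    have hpos : 0 < p gin * (x i gin - t) / p gout := by
      have := sub_pos.mpr h
      positivity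
    have hc : p gout * (p gin * (x i gin - t) / p gout) = p gin * (x i gin - t) := by
      field_simp
    have := hmax ht0.le (add_nonneg hxout.le hpos.le) href0 (by linarith)
    rw [min_self, min_eq_right h.le] at this
    nlinarith [mul_pos hs hpos]
  refine ⟨?_, hupper⟩
  have hH : 0 < H := hHlow0.trans_le hHlowH
  have hk0 : 0 < k := by linarith
  have h3k : 0 < 3 / k := by positivity
  by_contra! hlow
  have hlt : x i gin < t := by linarith
  have hswap : a * p gout ≤ s * p gin := by
    by_contra! h
    set d := min (t - x i gin) (p gout * x i gout / p gin) with hd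
    have hd0 : 0 < d := lt_min (by linarith) (by positivity)
    have hdt : d ≤ t - x i gin := min_le_left _ _
    have hd' : p gin * d ≤ p gout * x i gout := by
      have := (le_div_iff₀ hpin0).mp (min_le_right (t - x i gin) (p gout * x i gout / p gin))
      rw [← hd] at this
      linarith
    have hv : 0 ≤ x i gout - p gin * d / p gout := by
      rw [sub_nonneg, div_le_iff₀ hpout]
      linarith
    have hc : p gout * (p gin * d / p gout) = p gin * d := by field_simp
    have := hmax (u := x i gin + d) (by linarith) hv href0 (by linarith)
    rw [min_eq_left (by linarith), min_eq_left hupper] at this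
    have hle : a * d ≤ s * (p gin * d / p gout) := by linarith
    rw [← mul_div_assoc, le_div_iff₀ hpout] at hle
    nlinarith
  have hpoutL : p gout ≤ s * H := by
    nlinarith [mul_le_mul_of_nonneg_left hpinH hs.le, mul_le_mul_of_nonneg_right ha hpout.le]
  have hs20 : s * (20 * k) ≤ 1 := (le_div_iff₀ (by positivity)).mp hsk
  have hs1 : s < 1 := by nlinarith
  have hpoutH : p gout < H := by nlinarith
  have hspend : t * Hlow ≤ p gin * x i gin + p gout * x i gout := by
    have hrest : 0 ≤ t * Hlow - p gin * x i gin := by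
      have h₁ : 0 ≤ p gout * x i gout := by positivity
      have h₂ := mul_nonneg (heq.1 ref) href0
      linarith
    have hc : p gout * ((t * Hlow - p gin * x i gin) / p gout) = t * Hlow - p gin * x i gin := by
      field_simp
    have := hmax hin0 (div_nonneg hrest hpout.le) le_rfl (by linarith)
    have h₁ : s * ((t * Hlow - p gin * x i gin) / p gout) ≤ s * x i gout + x i ref := by linarith
    rw [← mul_div_assoc, div_le_iff₀ hpout] at h₁
    have hr : s * p ref = H := by rw [href]; field_simp
    have h₂ := mul_le_mul_of_nonneg_left hcost hs.le
    have h₃ : (s * p ref) * x i ref ≤ p gout * x i ref := by linarith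
    rw [hr] at h₃
    have h₄ : x i ref ≤ 0 := by nlinarith
    have h₅ : x i ref = 0 := le_antisymm h₄ href0
    rw [h₅] at h₁
    nlinarith
  exact hlow.not_ge (input_lower_bound hε1 hs ht0 ht2 hk hsk hH hHhigh hratio hpinH hpoutL hin0
    hxout.le hout1 hspend)
end

section
/- In the gadget setting, let 0 ≤ ε < 1/11 and let (p, x) be an ε-approximate market equilibrium. Let j be a good with 0 < p_j ≤ H and let i₁ ≠ i₂ be buyers such that each i_m (m = 1, 2) is one of the following: (a) the auxiliary buyer aux(j, t); (b) a NOT-inverter whose input good is j and whose output good out_m satisfies p_{out_m} > 0 and x_{i_m,out_m} > 0; (c) a NAND-inverter having j as one of its input goods, whose other input good has price in (0, H], and whose output good out_m satisfies p_{out_m} > 0 and x_{i_m,out_m} > 0. Then 2·(t − 5/k) ≤ x_{i₁,j} + x_{i₂,j} ≤ 2t. -/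
open Finset

variable {G B : Type} [Fintype G] [Fintype B]

/-- Buyer `i` is one of the two "external" purchasers of good `j`:
the auxiliary buyer `aux(j, t)`; a NOT-inverter with input good `j` whose
output good has positive price and of which `i` buys a positive amount; or a
NAND-inverter having `j` as one of its input goods, whose other input good has
price in `(0, H]`, and whose output good has positive price and of which `i`
buys a positive amount. -/
def PurchaserAt {G B : Type} [Fintype G] [Fintype B]
    (M : FisherMarket G B) (p : G → ℝ) (x : B → G → ℝ)
    (s a t Hlow Hhigh H : ℝ) (ref j : G) (i : B) : Prop :=
  IsAuxBuyer M s Hhigh ref j t i ∨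
  (∃ gout, IsNotInverter M s a t Hlow ref j gout i ∧
    0 < p gout ∧ 0 < x i gout) ∨
  (∃ g2 gout, (IsNandInverter M s a t Hlow ref j g2 gout i ∨
      IsNandInverter M s a t Hlow ref g2 j gout i) ∧
    0 < p g2 ∧ p g2 ≤ H ∧ 0 < p gout ∧ 0 < x i gout)

namespace FisherMarket

variable {M : FisherMarket G B} {p : G → ℝ} {i : B} {x : G → ℝ}

/-- Trading an amount of `g` for an affordable amount of `h` cannot improve an optimal bundle. -/
lemma IsOptimal.exchange (hx : M.IsOptimal p i x) {g h : G} (hgh : g ≠ h) {α β : ℝ}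
    (hα : α ≤ x g) (hβ : 0 ≤ β) (hcost : p h * β ≤ p g * α) :
    M.util i g (x g - α) + M.util i h (x h + β) ≤ M.util i g (x g) + M.util i h (x h) := by
  classical
  have split (f : G → ℝ) : ∑ l, f l = f g + (f h + ∑ l ∈ (univ.erase g).erase h, f l) := by
    rw [add_sum_erase _ _ (by simp [hgh.symm]), add_sum_erase _ _ (mem_univ g)]
  set y : G → ℝ := Function.update (Function.update x g (x g - α)) h (x h + β) with hy
  have yh : y h = x h + β := by simp [hy]
  have yg : y g = x g - α := by simp [hy, hgh]
  have yl (l : G) (hl : l ∈ (univ.erase g).erase h) : y l = x l := by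
    simp only [mem_erase] at hl
    simp [hy, hl.1, hl.2.1]
  obtain ⟨⟨hpos, hbud⟩, hopt⟩ := hx
  have hy0 (l : G) : 0 ≤ y l := by
    by_cases h1 : l = h
    · subst h1; rw [yh]; linarith [hpos l]
    by_cases h2 : l = g
    · subst h2; rw [yg]; linarith
    rw [yl l (by simp [h1, h2])]
    exact hpos l
  have key := hopt y ⟨hy0, ?_⟩
  · unfold totalUtil at key
    rw [split, split (fun l => M.util i l (x l)), yh, yg,
      sum_congr rfl (fun l hl => by rw [yl l hl])] at key
    linarith
  · rw [split] at hbud ⊢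
    rw [yh, yg, sum_congr rfl (fun l hl => by rw [yl l hl])]
    linarith

/-- A buyer with linear utility for a good of positive price spends the whole budget. -/
lemma IsOptimal.sum_eq_budget (hx : M.IsOptimal p i x) {r : G} (hr : 0 < p r)
    (hu : ∀ y ∈ Set.Ici (0 : ℝ), M.util i r y = y) : ∑ l, p l * x l = M.budget i := by
  classical
  refine le_antisymm hx.1.2 (not_lt.mp fun hlt => ?_)
  obtain ⟨⟨hpos, -⟩, hopt⟩ := hx
  set β : ℝ := (M.budget i - ∑ l, p l * x l) / p r with hβ
  have hβ0 : 0 < β := div_pos (by linarith) hr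
  have hβr : p r * β = M.budget i - ∑ l, p l * x l := by rw [hβ]; field_simp
  set y : G → ℝ := Function.update x r (x r + β) with hy
  have yr : y r = x r + β := by simp [hy]
  have yl (l : G) (hl : l ∈ univ.erase r) : y l = x l := by
    simp only [mem_erase] at hl
    simp [hy, hl.1]
  have hy0 (l : G) : 0 ≤ y l := by
    by_cases h1 : l = r
    · subst h1; rw [yr]; linarith [hpos l]
    rw [yl l (by simp [h1])]
    exact hpos l
  have key := hopt y ⟨hy0, ?_⟩
  · unfold totalUtil at key
    rw [← add_sum_erase _ _ (mem_univ r), ← add_sum_erase _ (fun l => M.util i l (x l))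
      (mem_univ r), yr, sum_congr rfl (fun l hl => by rw [yl l hl]),
      hu _ (hpos r), hu _ (by simpa using add_nonneg (hpos r) hβ0.le)] at key
    linarith
  · rw [← add_sum_erase _ _ (mem_univ r), yr, sum_congr rfl (fun l hl => by rw [yl l hl])]
    rw [← add_sum_erase _ _ (mem_univ r)] at hβr
    linarith

/-- No good of positive price is bought beyond its satiation point. -/
lemma IsOptimal.le_of_satiated_s9 (hx : M.IsOptimal p i x) {r g : G} (hgr : g ≠ r)
    (hr : 0 < p r) (hg : 0 < p g) (hu : ∀ y ∈ Set.Ici (0 : ℝ), M.util i r y = y) {b : ℝ}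
    (hb : 0 ≤ b) (hsat : ∀ y, b ≤ y → M.util i g y = M.util i g b) : x g ≤ b := by
  by_contra! hlt
  have hβ : 0 < p g * (x g - b) / p r := div_pos (mul_pos hg (by linarith)) hr
  have key := hx.exchange hgr (α := x g - b) (β := p g * (x g - b) / p r) (by linarith) hβ.le
    (by field_simp; exact le_rfl)
  rw [hsat _ (by linarith : b ≤ x g - (x g - b)), hsat _ hlt.le, hu _ (hx.1.1 r),
    hu _ (by simpa using add_nonneg (hx.1.1 r) hβ.le)] at key
  linarith

/-- No money is spent on goods with zero utility. -/
lemma IsOptimal.spend_eq_zero (hx : M.IsOptimal p i x) {r g : G} (hgr : g ≠ r)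
    (hr : 0 < p r) (hg : 0 ≤ p g) (hu : ∀ y ∈ Set.Ici (0 : ℝ), M.util i r y = y)
    (hzero : ∀ y ∈ Set.Ici (0 : ℝ), M.util i g y = 0) : p g * x g = 0 := by
  rcases hg.eq_or_lt with h | h
  · rw [← h, zero_mul]
  · have := hx.le_of_satiated_s9 hgr hr h hu le_rfl fun y hy => by
      rw [hzero y hy, hzero 0 Set.self_mem_Ici]
    rw [le_antisymm this (hx.1.1 g), mul_zero]

/-- A purchased good with linear utility has at least the bang per buck of an unsatiated good. -/
lemma IsOptimal.bang_per_buck_le (hx : M.IsOptimal p i x) {g h : G} (hgh : g ≠ h)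
    (hg : 0 < p g) (hh : 0 < p h) {c d t : ℝ}
    (hug : ∀ y ∈ Set.Ici (0 : ℝ), M.util i g y = d * y)
    (huh : ∀ y ∈ Set.Ici (0 : ℝ), M.util i h y = c * min y t)
    (hxg : 0 < x g) (hxh : x h < t) : c * p g ≤ d * p h := by
  set α := min (x g) ((t - x h) * p h / p g) with hα
  have hα0 : 0 < α := lt_min hxg (div_pos (mul_pos (by linarith) hh) hg)
  have hαg : α ≤ x g := min_le_left _ _
  have hαh : p g * α ≤ (t - x h) * p h := by
    have : α ≤ (t - x h) * p h / p g := min_le_right _ _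
    rw [le_div_iff₀ hg] at this
    linarith
  have hβ0 : 0 < p g * α / p h := div_pos (mul_pos hg hα0) hh
  have hβt : p g * α / p h ≤ t - x h := by rwa [div_le_iff₀ hh]
  have key := hx.exchange hgh hαg hβ0.le (by field_simp; exact le_rfl)
  rw [hug _ (by simpa using hαg), hug _ (hx.1.1 g), huh _ (hx.1.1 h),
    huh _ (by simpa using add_nonneg (hx.1.1 h) hβ0.le), min_eq_left hxh.le,
    min_eq_left (by linarith)] at key
  have h1 : c * (p g * α / p h) ≤ d * α := by linarith
  rw [← mul_div_assoc, div_le_iff₀ hh] at h1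
  exact le_of_mul_le_mul_right (by linarith) hα0

/-- Each buyer's share of a good is at most `1 + ε` at an `ε`-approximate equilibrium. -/
lemma IsApproxEquilibrium.le_one_add_s9 {ε : ℝ} {x : B → G → ℝ}
    (heq : M.IsApproxEquilibrium ε p x) (i : B) (g : G) : x i g ≤ 1 + ε := by
  have h1 := (abs_le.mp (heq.2.2 g)).2
  have h2 := single_le_sum (f := fun i => x i g) (fun i _ => (heq.2.1 i).1.1 g) (mem_univ i)
  linarith

end FisherMarket

lemma IsNandInverter.symm {M : FisherMarket G B} {s a t Hlow : ℝ} {ref g1 g2 gout : G} {i : B}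
    (h : IsNandInverter M s a t Hlow ref g1 g2 gout i) :
    IsNandInverter M s a t Hlow ref g2 g1 gout i := by
  obtain ⟨h1, h2, h3, h4, h5, h6, h7, h8, h9, h10, h11, h12⟩ := h
  exact ⟨h1.symm, h3, h2, h5, h4, h6, h7, h9, h8, h10, h11,
    fun l a1 a2 a3 a4 => h12 l a2 a1 a3 a4⟩

section Purchasers

variable {M : FisherMarket G B} {p : G → ℝ} {i : B} {s a t k H Hlow Hhigh : ℝ} {ref j : G}

/-- The auxiliary buyer `aux(j, t)` buys exactly `t` units of `j`. -/
lemma IsAuxBuyer.purchase_eq {x : G → ℝ} (hi : IsAuxBuyer M s Hhigh ref j t i)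
    (hp : ∀ l, 0 ≤ p l) (hx : M.IsOptimal p i x) (hs : 0 < s) (ht : 0 < t) (hH : 0 < H)
    (hHhigh : H ≤ Hhigh) (href : p ref = H / s) (hpj0 : 0 < p j) (hpjH : p j ≤ H) :
    x j = t := by
  classical
  obtain ⟨hjr, -, -, hb, huj, hur, huz⟩ := hi
  have hr : 0 < p ref := href ▸ div_pos hH hs
  have hle : x j ≤ t := hx.le_of_satiated_s9 hjr hr hpj0 hur ht.le fun y hy => by
    rw [huj y (ht.le.trans hy), huj t ht.le, min_eq_right hy, min_self]
  refine hle.antisymm (not_lt.mp fun hlt => ?_)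
  have hxr : x ref = 0 := by
    refine ((hx.1.1 ref).eq_or_lt.resolve_right fun hpos => ?_).symm
    have := hx.bang_per_buck_le hjr.symm hr hpj0 (d := 1) (fun y hy => by rw [hur y hy, one_mul])
      huj hpos hlt
    have e : 2 * s * p ref = 2 * H := by rw [href]; field_simp
    linarith
  have hsum := hx.sum_eq_budget hr hur
  rw [← sum_subset (subset_univ {j, ref}) fun l _ hl => ?_, sum_pair hjr, hxr, hb] at hsum
  · nlinarith
  · simp only [mem_insert, mem_singleton, not_or] at hl
    exact hx.spend_eq_zero hl.2 hr (hp l) hur (huz l hl.1 hl.2)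

/-- An unsatiated input good leaves no spending on `ref` and forces a cheap output good. -/
lemma input_unsatiated {x : G → ℝ} {gout : G} (hx : M.IsOptimal p i x)
    (hjo : j ≠ gout) (hjr : j ≠ ref) (hs : 0 < s) (hsa : s < a)
    (hH : 0 < H) (href : p ref = H / s) (hpj0 : 0 < p j) (hpjH : p j ≤ H)
    (huj : ∀ y ∈ Set.Ici (0 : ℝ), M.util i j y = a * min y t)
    (huo : ∀ y ∈ Set.Ici (0 : ℝ), M.util i gout y = s * y)
    (hur : ∀ y ∈ Set.Ici (0 : ℝ), M.util i ref y = y)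
    (hpo : 0 < p gout) (hxo : 0 < x gout) (hlt : x j < t) :
    x ref = 0 ∧ a * p gout ≤ s * p j := by
  have hr : 0 < p ref := href ▸ div_pos hH hs
  refine ⟨((hx.1.1 ref).eq_or_lt.resolve_right fun hpos => ?_).symm,
    hx.bang_per_buck_le hjo.symm hpo hpj0 huo huj hxo hlt⟩
  have := hx.bang_per_buck_le hjr.symm hr hpj0 (d := 1) (fun y hy => by rw [hur y hy, one_mul])
    huj hpos hlt
  have e : s * p ref = H := by rw [href]; field_simp
  nlinarith [mul_pos (sub_pos.mpr hsa) hr]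

/-- Fewer than `20` units of a cheap output good cost less than a `1 / k` fraction of the input
price. -/
lemma spend_lt_of_cheap {q po xo : ℝ} (ha : 1 ≤ a) (hk : 0 < k)
    (hsk : s ≤ 1 / (20 * k)) (hq : 0 < q) (hcheap : a * po ≤ s * q) (hpo : 0 < po)
    (hxo : xo < 20) : k * (po * xo) < q := by
  have h1 : po ≤ s * q := by nlinarith
  have h2 : s * (20 * k) ≤ 1 := by rwa [le_div_iff₀ (by positivity)] at hsk
  calc k * (po * xo) < k * (po * 20) := by gcongr
    _ ≤ k * (s * q * 20) := by gcongr
    _ = s * (20 * k) * q := by ring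
    _ ≤ 1 * q := by gcongr
    _ = q := one_mul q

/-- A NOT-inverter that buys its output good buys between `t - 5 / k` and `t` units of input. -/
lemma IsNotInverter.purchase_bounds {x : G → ℝ} {gout : G}
    (hi : IsNotInverter M s a t Hlow ref j gout i) (hp : ∀ l, 0 ≤ p l)
    (hx : M.IsOptimal p i x) (hs : 0 < s) (hsa : s < a) (ha : 1 ≤ a) (ht : 0 < t)
    (ht2 : t ≤ 1 / 2) (hk : 0 < k) (hsk : s ≤ 1 / (20 * k)) (hH : 0 < H)
    (hbudget : H * (k - 4) ≤ k * Hlow) (hk4 : 4 < k) (href : p ref = H / s) (hpj0 : 0 < p j)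
    (hpjH : p j ≤ H) (hpo : 0 < p gout) (hxo : 0 < x gout) (hxo1 : x gout < 20) :
    t - 5 / k ≤ x j ∧ x j ≤ t := by
  classical
  obtain ⟨hjo, hjr, hor, hb, huj, huo, hur, huz⟩ := hi
  have hr : 0 < p ref := href ▸ div_pos hH hs
  have hle : x j ≤ t := hx.le_of_satiated_s9 hjr hr hpj0 hur ht.le fun y hy => by
    rw [huj y (ht.le.trans hy), huj t ht.le, min_eq_right hy, min_self]
  refine ⟨not_lt.mp fun hlt => ?_, hle⟩
  have hk5 : 0 < 5 / k := by positivity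
  obtain ⟨hxr, hcheap⟩ := input_unsatiated hx hjo hjr hs hsa hH href hpj0 hpjH huj huo hur hpo
    hxo (by linarith)
  have hsum := hx.sum_eq_budget hr hur
  rw [← sum_subset (subset_univ {j, gout, ref}) fun l _ hl => ?_, sum_insert (by simp [hjo, hjr]),
    sum_pair hor, hxr, hb] at hsum
  · have hspend := spend_lt_of_cheap ha hk hsk hpj0 hcheap hpo hxo1
    have hkx : k * x j < k * t - 5 := by
      have := mul_lt_mul_of_pos_left hlt hk
      rwa [mul_sub, mul_div_cancel₀ _ hk.ne'] at this
    have h1 := mul_lt_mul_of_pos_left hkx hpj0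
    have h2 := mul_le_mul_of_nonneg_left hbudget ht.le
    have h3 : t * (p j * (k - 4)) ≤ t * (H * (k - 4)) := by
      gcongr
    have h4 : k * (p j * x j) + k * (p gout * x gout) = t * (k * Hlow) := by
      linear_combination k * hsum
    nlinarith [mul_le_mul_of_nonneg_left ht2 hpj0.le]
  · simp only [mem_insert, mem_singleton, not_or] at hl
    exact hx.spend_eq_zero hl.2.2 hr (hp l) hur (huz l hl.1 hl.2.1 hl.2.2)

/-- A NAND-inverter that buys its output good, and whose other input good costs at most `H`,
buys between `t - 5 / k` and `t` units of its first input good. -/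
lemma IsNandInverter.purchase_bounds {x : G → ℝ} {g gout : G}
    (hi : IsNandInverter M s a t Hlow ref j g gout i) (hp : ∀ l, 0 ≤ p l)
    (hx : M.IsOptimal p i x) (hs : 0 < s) (hsa : s < a) (ha : 1 ≤ a) (ht : 0 < t)
    (ht2 : t ≤ 1 / 2) (hk : 0 < k) (hsk : s ≤ 1 / (20 * k)) (hH : 0 < H)
    (hbudget : H * (k - 4) ≤ k * Hlow) (hk8 : 8 < k) (href : p ref = H / s) (hpj0 : 0 < p j)
    (hpjH : p j ≤ H) (hpg0 : 0 < p g) (hpgH : p g ≤ H) (hpo : 0 < p gout) (hxo : 0 < x gout)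
    (hxo1 : x gout < 20) : t - 5 / k ≤ x j ∧ x j ≤ t := by
  classical
  obtain ⟨hjg, hjo, hgo, hjr, hgr, hor, hb, huj, hug, huo, hur, huz⟩ := hi
  have hr : 0 < p ref := href ▸ div_pos hH hs
  have hle : x j ≤ t := hx.le_of_satiated_s9 hjr hr hpj0 hur ht.le fun y hy => by
    rw [huj y (ht.le.trans hy), huj t ht.le, min_eq_right hy, min_self]
  have hleg : x g ≤ t := hx.le_of_satiated_s9 hgr hr hpg0 hur ht.le fun y hy => by
    rw [hug y (ht.le.trans hy), hug t ht.le, min_eq_right hy, min_self]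
  refine ⟨not_lt.mp fun hlt => ?_, hle⟩
  have hk5 : 0 < 5 / k := by positivity
  obtain ⟨hxr, hcheap⟩ := input_unsatiated hx hjo hjr hs hsa hH href hpj0 hpjH huj huo hur hpo
    hxo (by linarith)
  have hsum := hx.sum_eq_budget hr hur
  rw [← sum_subset (subset_univ {j, g, gout, ref}) fun l _ hl => ?_,
    sum_insert (by simp [hjg, hjo, hjr]), sum_insert (by simp [hgo, hgr]),
    sum_pair hor, hxr, hb] at hsum
  · have hspend := spend_lt_of_cheap ha hk hsk hpj0 hcheap hpo hxo1
    have hkx : k * x j < k * t - 5 := by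
      have := mul_lt_mul_of_pos_left hlt hk
      rwa [mul_sub, mul_div_cancel₀ _ hk.ne'] at this
    have h1 := mul_lt_mul_of_pos_left hkx hpj0
    have h2 := mul_le_mul_of_nonneg_left hbudget ht.le
    have h3 : t * (p j * (k - 8)) ≤ t * (H * (k - 8)) := by
      gcongr
    have h4 : k * (p j * x j) + k * (p g * x g) + k * (p gout * x gout)
        = 2 * (t * (k * Hlow)) := by
      linear_combination k * hsum
    have h5 : k * (p g * x g) ≤ k * (H * t) := by
      gcongr
      exact hx.1.1 g
    nlinarith [mul_le_mul_of_nonneg_left ht2 hpj0.le]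
  · simp only [mem_insert, mem_singleton, not_or] at hl
    exact hx.spend_eq_zero hl.2.2.2 hr (hp l) hur (huz l hl.1 hl.2.1 hl.2.2.1 hl.2.2.2)

/-- Every purchaser of `j` buys between `t - 5 / k` and `t` units of `j`. -/
lemma PurchaserAt.purchase_bounds {ε : ℝ} {x : B → G → ℝ}
    (h : PurchaserAt M p x s a t Hlow Hhigh H ref j i) (hε : ε < 1 / 11)
    (heq : M.IsApproxEquilibrium ε p x) (hs : 0 < s) (hsa : s < a) (ha : 1 ≤ a)
    (ht : 0 < t) (ht2 : t ≤ 1 / 2) (hk : 110 < k) (hsk : s ≤ 1 / (20 * k)) (hH : 0 < H)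
    (hHhigh : H ≤ Hhigh) (hratio : 1 - 4 / k ≤ Hlow / Hhigh) (href : p ref = H / s)
    (hpj0 : 0 < p j) (hpjH : p j ≤ H) : t - 5 / k ≤ x i j ∧ x i j ≤ t := by
  have hk0 : 0 < k := by linarith
  have hx := heq.2.1 i
  have hsold (l : G) : x i l < 20 := by linarith [heq.le_one_add_s9 i l]
  have hbudget : H * (k - 4) ≤ k * Hlow := by
    rw [le_div_iff₀ (by linarith)] at hratio
    calc H * (k - 4) ≤ Hhigh * (k - 4) := by gcongr; linarith
      _ = k * ((1 - 4 / k) * Hhigh) := by field_simp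
      _ ≤ k * Hlow := by gcongr
  rcases h with h | ⟨gout, h, hpo, hxo⟩ | ⟨g, gout, h, hpg0, hpgH, hpo, hxo⟩
  · have hk5 : 0 < 5 / k := by positivity
    have := h.purchase_eq heq.1 hx hs ht hH hHhigh href hpj0 hpjH
    constructor <;> linarith
  · exact h.purchase_bounds heq.1 hx hs hsa ha ht ht2 hk0 hsk hH hbudget (by linarith) href
      hpj0 hpjH hpo hxo (hsold gout)
  · exact (h.elim id IsNandInverter.symm).purchase_bounds heq.1 hx hs hsa ha ht ht2 hk0 hsk hH
      hbudget (by linarith) href hpj0 hpjH hpg0 hpgH hpo hxo (hsold gout)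

end Purchasers

/-- at an ε-approximate equilibrium (0 ≤ ε < 1/11), the two
external purchasers of a good `j` with `0 < p_j ≤ H` together buy between
`2(t - 5/k)` and `2t` units of `j`. -/
theorem stmt_9 {G B : Type} [Fintype G] [Fintype B]
    (M : FisherMarket G B) (ε : ℝ) (hε0 : 0 ≤ ε) (hε1 : ε < 1 / 11)
    (p : G → ℝ) (x : B → G → ℝ) (heq : M.IsApproxEquilibrium ε p x)
    (s a t k H Hlow Hhigh : ℝ)
    (hs : 0 < s) (hsa : s < a) (ha : 1 ≤ a)
    (ht0 : 0 < t) (ht2 : t ≤ 1 / 2)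
    (hk : 110 < k) (hsk : s ≤ 1 / (20 * k))
    (hHlow0 : 0 < Hlow) (hHlowH : Hlow ≤ H) (hHhigh : H ≤ Hhigh)
    (hratio : 1 - 4 / k ≤ Hlow / Hhigh)
    (ref : G) (href : p ref = H / s)
    (j : G) (hpj0 : 0 < p j) (hpjH : p j ≤ H)
    (i1 i2 : B) (hne : i1 ≠ i2)
    (h1 : PurchaserAt M p x s a t Hlow Hhigh H ref j i1)
    (h2 : PurchaserAt M p x s a t Hlow Hhigh H ref j i2) :
    2 * (t - 5 / k) ≤ x i1 j + x i2 j ∧ x i1 j + x i2 j ≤ 2 * t := by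
  have hH : 0 < H := hHlow0.trans_le hHlowH
  have b1 := h1.purchase_bounds hε1 heq hs hsa ha ht0 ht2 hk hsk hH hHhigh hratio href hpj0 hpjH
  have b2 := h2.purchase_bounds hε1 heq hs hsa ha ht0 ht2 hk hsk hH hHhigh hratio href hpj0 hpjH
  constructor <;> linarith [b1.1, b1.2, b2.1, b2.2]
end

section
/- In the gadget setting, let ε ≥ 0 and r ∈ [0, 1] satisfy 1 − 2t − r − ε > 0, and let (p, x) be an ε-approximate market equilibrium. Let i be a NOT-inverter with input good in and output good out, suppose 0 < p_in ≤ H and p_out > 0, and suppose the total amount of good out allocated to buyers other than i satisfies Σ_{i'≠i} x_{i',out} ≤ 2t + r. Then p_out ≤ max( L, (H_low − p_in)·t/(1 − 2t − r − ε) ). -/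
open Finset

variable {G B : Type} [Fintype G] [Fintype B]

/-- A buyer holding an optimal bundle with a positive amount of a good `g₂` of constant marginal
utility `s` is saturated (up to `t`) in any good `g₁` whose utility `a * min y t` gives
strictly more utility per unit of money. -/
theorem FisherMarket.IsOptimal.saturated {G B : Type} [Fintype G] [Fintype B]
    {M : FisherMarket G B} {p : G → ℝ} {i : B} {z : G → ℝ} (hz : M.IsOptimal p i z)
    {g₁ g₂ : G} (hne : g₁ ≠ g₂) {a s t : ℝ}
    (hu₁ : ∀ y ∈ Set.Ici (0 : ℝ), M.util i g₁ y = a * min y t)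
    (hu₂ : ∀ y ∈ Set.Ici (0 : ℝ), M.util i g₂ y = s * y)
    (hp₁ : 0 < p g₁) (hp₂ : 0 < p g₂) (hbpb : s * p g₁ < a * p g₂) (hz₂ : 0 < z g₂) :
    t ≤ z g₁ := by
  classical
  by_contra! hlt
  obtain ⟨⟨hz0, hbud⟩, hopt⟩ := hz
  obtain ⟨c, hc0, hct, hcz⟩ : ∃ c > 0, z g₁ + c * p g₂ ≤ t ∧ c * p g₁ ≤ z g₂ := by
    refine ⟨min ((t - z g₁) / p g₂) (z g₂ / p g₁),
      lt_min (div_pos (sub_pos.2 hlt) hp₂) (div_pos hz₂ hp₁), ?_, ?_⟩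
    · have := (le_div_iff₀ hp₂).1 (min_le_left ((t - z g₁) / p g₂) (z g₂ / p g₁))
      linarith
    · exact (le_div_iff₀ hp₁).1 (min_le_right _ _)
  set y : G → ℝ := fun j =>
    if j = g₁ then z g₁ + c * p g₂ else if j = g₂ then z g₂ - c * p g₁ else z j with hy
  have hy₁ : y g₁ = z g₁ + c * p g₂ := by simp [hy]
  have hy₂ : y g₂ = z g₂ - c * p g₁ := by simp [hy, hne.symm]
  have hyj : ∀ j, j ≠ g₁ ∧ j ≠ g₂ → y j = z j := fun j hj => by simp [hy, hj.1, hj.2]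
  have hy0₁ : 0 ≤ y g₁ := hy₁ ▸ add_nonneg (hz0 g₁) (mul_pos hc0 hp₂).le
  have hy0₂ : 0 ≤ y g₂ := hy₂ ▸ sub_nonneg.2 hcz
  have hfeas : M.Feasible p i y := by
    refine ⟨fun j => ?_, ?_⟩
    · by_cases h₁ : j = g₁
      · exact h₁ ▸ hy0₁
      by_cases h₂ : j = g₂
      · exact h₂ ▸ hy0₂
      exact hyj j ⟨h₁, h₂⟩ ▸ hz0 j
    · have hcost : ∑ j, (p j * y j - p j * z j) = 0 := by
        rw [Fintype.sum_eq_add g₁ g₂ hne fun j hj => by rw [hyj j hj, sub_self], hy₁, hy₂]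
        ring
      rw [Finset.sum_sub_distrib] at hcost
      linarith
  have hgain : ∑ j, (M.util i j (y j) - M.util i j (z j)) = c * (a * p g₂ - s * p g₁) := by
    rw [Fintype.sum_eq_add g₁ g₂ hne fun j hj => by rw [hyj j hj, sub_self],
      hu₁ _ hy0₁, hu₁ _ (hz0 g₁), hu₂ _ hy0₂, hu₂ _ (hz0 g₂), hy₁, hy₂,
      min_eq_left hct, min_eq_left hlt.le]
    ring
  rw [Finset.sum_sub_distrib] at hgain
  have := hopt y hfeas
  unfold FisherMarket.totalUtil at this
  have := mul_pos hc0 (sub_pos.2 hbpb)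
  linarith

/-- upper bound on the output price of a NOT gadget at an
ε-approximate equilibrium, when buyers other than the inverter get at most
`2t + r` units of the output good. -/
theorem stmt_10 {G B : Type} [Fintype G] [Fintype B] [DecidableEq B]
    (M : FisherMarket G B) (ε : ℝ) (hε0 : 0 ≤ ε)
    (p : G → ℝ) (x : B → G → ℝ) (heq : M.IsApproxEquilibrium ε p x)
    (s a t k H Hlow Hhigh : ℝ)
    (hs : 0 < s) (hsa : s < a) (ha : 1 ≤ a)
    (ht0 : 0 < t) (ht2 : t ≤ 1 / 2)
    (hk : 110 < k) (hsk : s ≤ 1 / (20 * k))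
    (hHlow0 : 0 < Hlow) (hHlowH : Hlow ≤ H) (hHhigh : H ≤ Hhigh)
    (hratio : 1 - 4 / k ≤ Hlow / Hhigh)
    (ref : G) (href : p ref = H / s)
    (r : ℝ) (hr0 : 0 ≤ r) (hr1 : r ≤ 1) (hpos : 0 < 1 - 2 * t - r - ε)
    (gin gout : G) (i : B) (hinv : IsNotInverter M s a t Hlow ref gin gout i)
    (hpin0 : 0 < p gin) (hpinH : p gin ≤ H) (hpout : 0 < p gout)
    (hsum : ∑ i' ∈ Finset.univ.erase i, x i' gout ≤ 2 * t + r) :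
    p gout ≤ max (s * H / a) ((Hlow - p gin) * t / (1 - 2 * t - r - ε)) := by
  obtain ⟨hp0, hopt, hclear⟩ := heq
  obtain ⟨hne, -, -, hbudget, huin, huout, -, -⟩ := hinv
  rw [le_max_iff, or_iff_not_imp_left, not_le]
  intro hL
  have hout : 1 - 2 * t - r - ε ≤ x i gout := by
    have h := (abs_le.1 (hclear gout)).1
    rw [← Finset.add_sum_erase _ _ (Finset.mem_univ i)] at h
    linarith
  have hbpb : s * p gin < a * p gout := by
    rw [div_lt_iff₀ (by linarith)] at hL
    nlinarith
  have hin : t ≤ x i gin :=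
    (hopt i).saturated hne huin huout hpin0 hpout hbpb (hpos.trans_le hout)
  rw [le_div_iff₀ hpos]
  obtain ⟨⟨hx0, hbud⟩, -⟩ := hopt i
  have hcost : p gin * x i gin + p gout * x i gout ≤ ∑ j, p j * x i j :=
    Finset.add_le_sum (fun j _ => mul_nonneg (hp0 j) (hx0 j))
      (Finset.mem_univ gin) (Finset.mem_univ gout) hne
  have := mul_le_mul_of_nonneg_left hin hpin0.le
  have := mul_le_mul_of_nonneg_left hout hpout.le
  linarith
end

section
/- In the gadget setting, assume additionally that t = 4/11, that H_high − H_low ≤ 2s/k, and that s/2 ≤ H ≤ 2s. Let 0 ≤ ε < 1/11, set r := 2/11, and let (p, x) be an ε-approximate market equilibrium. Let i be a NOT-inverter with input good in and output good out, suppose 0 < p_in ≤ H and p_out > 0, and suppose the total amount of good out allocated to buyers other than i satisfies 2t̄ + r ≤ Σ_{i'≠i} x_{i',out} ≤ 2t + r, where t̄ = t − 5/k. Then: (a) if p_in ≥ H then p_out ≤ L; (b) if p_in ≤ L then p_out ≥ H. -/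
open Finset

variable {G B : Type} [Fintype G] [Fintype B]

/-- A bundle of a NOT-inverter matters only through its amounts of the three goods it values:
the amounts in an optimal bundle are affordable, and they are at least as good as any other
affordable choice of three amounts. -/
theorem IsNotInverter.optimal_amounts {M : FisherMarket G B} {s a t Hlow : ℝ} {ref gin gout : G}
    {i : B} (hinv : IsNotInverter M s a t Hlow ref gin gout i) {p z : G → ℝ}
    (hp : ∀ j, 0 ≤ p j) (hz : M.IsOptimal p i z) :
    p gin * z gin + p gout * z gout + p ref * z ref ≤ t * Hlow ∧
    ∀ u v w : ℝ, 0 ≤ u → 0 ≤ v → 0 ≤ w → p gin * u + p gout * v + p ref * w ≤ t * Hlow →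
      a * min u t + s * v + w ≤ a * min (z gin) t + s * z gout + z ref := by
  classical
  obtain ⟨hio, hir, hor, hb, hin, hout, href, hother⟩ := hinv
  obtain ⟨⟨hz0, hzb⟩, hopt⟩ := hz
  have hsum : ∀ f : G → ℝ, ∑ j ∈ {gin, gout, ref}, f j = f gin + f gout + f ref := fun f => by
    rw [Finset.sum_insert (by simp [hio, hir]), Finset.sum_pair hor]; ring
  have hutil : ∀ y : G → ℝ, (∀ j, 0 ≤ y j) →
      M.totalUtil i y = a * min (y gin) t + s * y gout + y ref := fun y hy => by
    rw [← hin _ (hy gin), ← hout _ (hy gout), ← href _ (hy ref),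
      ← hsum fun j => M.util i j (y j)]
    refine (Finset.sum_subset (Finset.subset_univ _) fun j _ hj => ?_).symm
    simp only [Finset.mem_insert, Finset.mem_singleton, not_or] at hj
    exact hother j hj.1 hj.2.1 hj.2.2 _ (hy j)
  constructor
  · rw [← hb, ← hsum fun j => p j * z j]
    exact (Finset.sum_le_sum_of_subset_of_nonneg (Finset.subset_univ _)
      fun j _ _ => mul_nonneg (hp j) (hz0 j)).trans hzb
  · intro u v w hu hv hw hc
    let y : G → ℝ := fun j => if j = gin then u else if j = gout then v else if j = ref then w else 0
    have hyin : y gin = u := by simp [y]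
    have hyout : y gout = v := by simp [y, hio.symm]
    have hyref : y ref = w := by simp [y, hir.symm, hor.symm]
    have hy : ∀ j, 0 ≤ y j := fun j => by
      simp only [y]; split_ifs <;> first | assumption | exact le_rfl
    have hcost : ∑ j, p j * y j = p gin * u + p gout * v + p ref * w := by
      rw [← hyin, ← hyout, ← hyref, ← hsum fun j => p j * y j]
      refine (Finset.sum_subset (Finset.subset_univ _) fun j _ hj => ?_).symm
      simp only [Finset.mem_insert, Finset.mem_singleton, not_or] at hj
      simp [y, hj]
    have h := hopt y ⟨hy, by rw [hcost, hb]; exact hc⟩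
    rwa [hutil y hy, hutil z hz0, hyin, hyout, hyref] at h

/-- correctness of the NOT gate on pure inputs, with `t = 4/11`,
`r = 2/11`, `Hhigh - Hlow ≤ 2s/k` and `s/2 ≤ H ≤ 2s`:
(a) if `p_in ≥ H` then `p_out ≤ L`; (b) if `p_in ≤ L` then `p_out ≥ H`,
where `L = s·H/a`. -/
theorem stmt_12 {G B : Type} [Fintype G] [Fintype B] [DecidableEq B]
    (M : FisherMarket G B) (ε : ℝ) (hε0 : 0 ≤ ε) (hε1 : ε < 1 / 11)
    (p : G → ℝ) (x : B → G → ℝ) (heq : M.IsApproxEquilibrium ε p x)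
    (s a t k H Hlow Hhigh : ℝ)
    (hs : 0 < s) (hsa : s < a) (ha : 1 ≤ a)
    (ht0 : 0 < t) (ht2 : t ≤ 1 / 2)
    (hk : 110 < k) (hsk : s ≤ 1 / (20 * k))
    (hHlow0 : 0 < Hlow) (hHlowH : Hlow ≤ H) (hHhigh : H ≤ Hhigh)
    (hratio : 1 - 4 / k ≤ Hlow / Hhigh)
    (ref : G) (href : p ref = H / s)
    (ht411 : t = 4 / 11) (hgap : Hhigh - Hlow ≤ 2 * s / k)
    (hHs1 : s / 2 ≤ H) (hHs2 : H ≤ 2 * s)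
    (gin gout : G) (i : B) (hinv : IsNotInverter M s a t Hlow ref gin gout i)
    (hpin0 : 0 < p gin) (hpinH : p gin ≤ H) (hpout : 0 < p gout)
    (hsum1 : 2 * (t - 5 / k) + 2 / 11 ≤ ∑ i' ∈ Finset.univ.erase i, x i' gout)
    (hsum2 : ∑ i' ∈ Finset.univ.erase i, x i' gout ≤ 2 * t + 2 / 11) :
    (H ≤ p gin → p gout ≤ s * H / a) ∧
    (p gin ≤ s * H / a → H ≤ p gout) := by
  obtain ⟨hp, hx, hclear⟩ := heq
  obtain ⟨hcost, hopt⟩ := hinv.optimal_amounts hp (hx i)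
  have hx0 := (hx i).1.1
  have hin0 := hx0 gin
  have href0 := hx0 ref
  have hH : 0 < H := hHlow0.trans_le hHlowH
  have ha0 : 0 < a := hs.trans hsa
  have hpref : 0 < p ref := href ▸ div_pos hH hs
  have hspref : s * p ref = H := by rw [href]; field_simp
  have hk0 : 0 < k := by linarith
  have hk1 : 1 / k < 1 / 110 := one_div_lt_one_div_of_lt (by norm_num) hk
  have hk5 : 5 / k = 5 * (1 / k) := by ring
  have hsplit := Finset.add_sum_erase Finset.univ (fun b => x b gout) (Finset.mem_univ i)
  obtain ⟨hc1, hc2⟩ := abs_le.mp (hclear gout)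
  have hout0 : 0 < x i gout := by linarith
  have hout1 : x i gout < 3 / 11 := by linarith
  set q := x i gin
  set v := x i gout
  set w := x i ref
  constructor
  · intro hpin
    have hpin' : p gin = H := le_antisymm hpinH hpin
    by_contra! hL
    have hL' : s * H < p gout * a := (div_lt_iff₀ ha0).mp hL
    have hpv : 0 < p gout * v := mul_pos hpout hout0
    have hpw : 0 ≤ p ref * w := mul_nonneg hpref.le href0
    have hqt : q < t := by
      by_contra! h
      rw [hpin'] at hcost
      linarith [mul_le_mul_of_nonneg_left hHlowH ht0.le, mul_le_mul_of_nonneg_left h hH.le]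
    set d := min (t - q) (p gout * v / p gin)
    have hd : 0 < d := lt_min (by linarith) (div_pos hpv hpin0)
    have hdt : d ≤ t - q := min_le_left _ _
    have hdv : p gin * d ≤ p gout * v := by
      rw [mul_comm, ← le_div_iff₀ hpin0]; exact min_le_right _ _
    have hspend : p gout * (p gin * d / p gout) = p gin * d := by field_simp
    have h := hopt (q + d) (v - p gin * d / p gout) w (by linarith)
      (sub_nonneg.mpr ((div_le_iff₀ hpout).mpr (by linarith))) href0 (by linarith)
    rw [min_eq_left (by linarith : q + d ≤ t), min_eq_left hqt.le] at h
    have h' : a * d ≤ s * (p gin * d / p gout) := by linarith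
    have h'' := mul_le_mul_of_nonneg_left h' hpout.le
    rw [mul_left_comm, mul_left_comm _ s, hspend, hpin'] at h''
    linarith [mul_lt_mul_of_pos_right hL' hd]
  · intro hpin
    by_contra! hlt
    have hw : w = 0 := by
      have hspend : p gout * (p ref * w / p gout) = p ref * w := by field_simp
      have h := hopt q (v + p ref * w / p gout) 0 hin0
        (add_nonneg hout0.le (div_nonneg (mul_nonneg hpref.le href0) hpout.le)) le_rfl
        (by linarith)
      have h' : s * (p ref * w / p gout) ≤ w := by linarith
      have h'' := mul_le_mul_of_nonneg_left h' hpout.le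
      rw [mul_left_comm, hspend, ← mul_assoc, hspref] at h''
      by_contra hw
      linarith [mul_lt_mul_of_pos_right hlt (lt_of_le_of_ne href0 (Ne.symm hw))]
    have hsL : s * H / a ≤ H / 110 := by
      have hs110 : s ≤ 1 / 110 := by
        refine hsk.trans (one_div_le_one_div_of_le (by norm_num) (by linarith))
      rw [div_le_iff₀ ha0]
      linarith [mul_le_mul_of_nonneg_right hs110 hH.le, mul_le_mul_of_nonneg_left ha hH.le]
    have hHlow : H * (106 / 110) ≤ Hlow := by
      have h : 2 * s / k = 2 * s * (1 / k) := by ring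
      linarith [mul_le_mul_of_nonneg_left hk1.le hs.le]
    have hb : 0 ≤ t * Hlow - p gin * t := by
      rw [ht411]; linarith
    have hspend : p gout * ((t * Hlow - p gin * t) / p gout) = t * Hlow - p gin * t := by
      field_simp
    have h := hopt t ((t * Hlow - p gin * t) / p gout) 0 ht0.le (div_nonneg hb hpout.le) le_rfl
      (by linarith)
    rw [min_self, hw] at h
    have hmin : a * min q t ≤ a * t := mul_le_mul_of_nonneg_left (min_le_right _ _) ha0.le
    have h' : (t * Hlow - p gin * t) / p gout ≤ v := le_of_mul_le_mul_left (by linarith) hs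
    rw [div_le_iff₀ hpout] at h'
    have hpv : v * p gout ≤ 3 / 11 * H :=
      mul_le_mul hout1.le hlt.le hpout.le (by norm_num)
    subst ht411
    linarith
end

section
/- In the gadget setting, assume additionally that t = 4/11. Let 0 ≤ ε < 1/11 and let (p, x) be an ε-approximate market equilibrium. Let i be a NAND-inverter with input goods in1, in2 and output good out, suppose p_out > 0, suppose the total amount of good out allocated to buyers other than i satisfies Σ_{i'≠i} x_{i',out} ≤ 10/11, and suppose p_in1 ≥ H and p_in2 ≥ H together with p_in1 ≤ H and p_in2 ≤ H (the latter bound holds for all goods in the construction, so both input prices equal H). Then p_out ≤ L. -/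
open Finset

variable {G B : Type} [Fintype G] [Fintype B]

/-- If an optimal bundle contains a positive amount of a good `g'` of constant marginal utility `s`,
then every good `g` of marginal utility `a` up to the threshold `t` with a strictly better
bang-per-buck is bought up to its threshold. -/
theorem FisherMarket.IsOptimal.threshold_le {M : FisherMarket G B} {p : G → ℝ} {i : B} {z : G → ℝ}
    (hz : M.IsOptimal p i z) {g g' : G} (hne : g ≠ g') {a s t : ℝ}
    (hg : ∀ y ∈ Set.Ici (0 : ℝ), M.util i g y = a * min y t)
    (hg' : ∀ y ∈ Set.Ici (0 : ℝ), M.util i g' y = s * y)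
    (hp : 0 < p g) (hp' : 0 < p g') (hz' : 0 < z g') (hbang : s * p g < a * p g') :
    t ≤ z g := by
  classical
  by_contra! hlt
  obtain ⟨⟨hz0, hbudget⟩, hopt⟩ := hz
  set d := min (t - z g) (z g' * p g' / p g)
  have hd : 0 < d := lt_min (by linarith) (by positivity)
  have hdt : d ≤ t - z g := min_le_left _ _
  have hdz : d * p g / p g' ≤ z g' := by
    rw [div_le_iff₀ hp', ← le_div_iff₀ hp]
    exact min_le_right _ _
  set y : G → ℝ := Function.update (Function.update z g (z g + d)) g' (z g' - d * p g / p g')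
  have hyg : y g = z g + d := by simp [y, hne]
  have hyg' : y g' = z g' - d * p g / p g' := by simp [y]
  have hyj : ∀ j, j ≠ g ∧ j ≠ g' → y j = z j := fun j hj => by simp [y, hj.1, hj.2]
  have hy0 : ∀ j, 0 ≤ y j := by
    intro j
    by_cases h : j = g
    · subst h
      linarith [hz0 j]
    by_cases h' : j = g'
    · subst h'
      linarith
    rw [hyj j ⟨h, h'⟩]
    exact hz0 j
  have hsum (f : G → ℝ → ℝ) : ∑ j, f j (y j) - ∑ j, f j (z j) =
      (f g (y g) - f g (z g)) + (f g' (y g') - f g' (z g')) := by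
    rw [← Finset.sum_sub_distrib]
    exact Fintype.sum_eq_add g g' hne fun j hj => by rw [hyj j hj, sub_self]
  have hcost := hsum fun j v => p j * v
  have hcancel : p g' * (d * p g / p g') = d * p g := by field_simp
  have hfeasible : M.Feasible p i y := by
    refine ⟨hy0, ?_⟩
    simp only [hyg, hyg'] at hcost
    linarith
  have hutil := hsum (M.util i)
  rw [hg _ (hy0 g), hg _ (hz0 g), hg' _ (hy0 g'), hg' _ (hz0 g'), hyg, hyg',
    min_eq_left (by linarith), min_eq_left hlt.le] at hutil
  have hgain : s * (d * p g / p g') < a * d := by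
    rw [← mul_div_assoc, div_lt_iff₀ hp']
    nlinarith
  have hle := hopt y hfeasible
  unfold FisherMarket.totalUtil at hle
  linarith

/-- a NAND gate with both input prices equal to `H` (i.e. both
at least `H` and at most `H`) has output price at most `L = s·H/a`, assuming
`t = 4/11` and that buyers other than the inverter get at most `10/11` units
of the output good. -/
theorem stmt_13 {G B : Type} [Fintype G] [Fintype B] [DecidableEq B]
    (M : FisherMarket G B) (ε : ℝ) (hε0 : 0 ≤ ε) (hε1 : ε < 1 / 11)
    (p : G → ℝ) (x : B → G → ℝ) (heq : M.IsApproxEquilibrium ε p x)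
    (s a t k H Hlow Hhigh : ℝ)
    (hs : 0 < s) (hsa : s < a) (ha : 1 ≤ a)
    (ht0 : 0 < t) (ht2 : t ≤ 1 / 2)
    (hk : 110 < k) (hsk : s ≤ 1 / (20 * k))
    (hHlow0 : 0 < Hlow) (hHlowH : Hlow ≤ H) (hHhigh : H ≤ Hhigh)
    (hratio : 1 - 4 / k ≤ Hlow / Hhigh)
    (ref : G) (href : p ref = H / s)
    (ht411 : t = 4 / 11)
    (gin1 gin2 gout : G) (i : B)
    (hinv : IsNandInverter M s a t Hlow ref gin1 gin2 gout i)
    (hpout : 0 < p gout)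
    (hsum : ∑ i' ∈ Finset.univ.erase i, x i' gout ≤ 10 / 11)
    (hpin1ge : H ≤ p gin1) (hpin2ge : H ≤ p gin2)
    (hpin1le : p gin1 ≤ H) (hpin2le : p gin2 ≤ H) :
    p gout ≤ s * H / a := by
  obtain ⟨hp0, hopt, hclear⟩ := heq
  obtain ⟨h12, h1o, h2o, -, -, -, hbudget, hu1, hu2, huo, -, -⟩ := hinv
  by_contra! hL
  have hH : 0 < H := by linarith
  have ha0 : 0 < a := by linarith
  have hxout : 0 < x i gout := by
    have hsplit := Finset.add_sum_erase Finset.univ (fun i' => x i' gout) (Finset.mem_univ i)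
    have := (abs_le.mp (hclear gout)).1
    linarith
  have hbang : s * H < a * p gout := by
    rw [div_lt_iff₀ ha0] at hL
    linarith
  have hp1 : p gin1 = H := le_antisymm hpin1le hpin1ge
  have hp2 : p gin2 = H := le_antisymm hpin2le hpin2ge
  have hx1 : t ≤ x i gin1 :=
    (hopt i).threshold_le h1o hu1 huo (hp1 ▸ hH) hpout hxout (hp1 ▸ hbang)
  have hx2 : t ≤ x i gin2 :=
    (hopt i).threshold_le h2o hu2 huo (hp2 ▸ hH) hpout hxout (hp2 ▸ hbang)
  have hspend : p gin1 * x i gin1 + p gin2 * x i gin2 + p gout * x i gout ≤ 2 * t * Hlow := by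
    classical
    rw [← hbudget]
    refine le_trans ?_ (hopt i).1.2
    have := Finset.sum_le_sum_of_subset_of_nonneg (Finset.subset_univ {gin1, gin2, gout})
      fun j _ _ => mul_nonneg (hp0 j) ((hopt i).1.1 j)
    rw [Finset.sum_insert (by simp [h12, h1o]), Finset.sum_pair h2o] at this
    linarith
  rw [hp1, hp2] at hspend
  nlinarith [mul_pos hpout hxout]
end

section
/- In the gadget setting, assume additionally that t = 4/11. Let 0 ≤ ε < 1/11, set r := 2/11, and let (p, x) be an ε-approximate market equilibrium. Let i be a NAND-inverter with input goods in1, in2 and output good out, suppose 0 < p_in1 ≤ H, 0 < p_in2 ≤ H, min(p_in1, p_in2) ≤ L, and p_out > 0, and suppose the total amount of good out allocated to buyers other than i satisfies Σ_{i'≠i} x_{i',out} ≥ 2t̄ + r, where t̄ = t − 5/k. Then p_out ≥ H. -/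
open Finset

variable {G B : Type} [Fintype G] [Fintype B]

/-- A nonnegative function sums to at least the sum of its values at four distinct points. -/
lemma add_four_le_sum {ι : Type*} [Fintype ι] {f : ι → ℝ} (hf : ∀ j, 0 ≤ f j) {a b c d : ι}
    (hab : a ≠ b) (hac : a ≠ c) (hbc : b ≠ c) (had : a ≠ d) (hbd : b ≠ d) (hcd : c ≠ d) :
    f a + f b + f c + f d ≤ ∑ j, f j := by
  classical
  have h : ∑ j ∈ ({a, b, c, d} : Finset ι), f j = f a + f b + f c + f d := by
    rw [Finset.sum_insert (by simp [hab, hac, had]), Finset.sum_insert (by simp [hbc, hbd]),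
      Finset.sum_pair hcd]
    ring
  rw [← h]
  exact Finset.sum_le_sum_of_subset_of_nonneg (Finset.subset_univ _) fun j _ _ => hf j

/-- A function vanishing off four distinct points sums to the sum of its values there. -/
lemma sum_eq_add_four {ι : Type*} [Fintype ι] {f : ι → ℝ} {a b c d : ι}
    (hab : a ≠ b) (hac : a ≠ c) (hbc : b ≠ c) (had : a ≠ d) (hbd : b ≠ d) (hcd : c ≠ d)
    (hf : ∀ j, j ≠ a → j ≠ b → j ≠ c → j ≠ d → f j = 0) :
    ∑ j, f j = f a + f b + f c + f d := by
  classical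
  have h : ∑ j ∈ ({a, b, c, d} : Finset ι), f j = f a + f b + f c + f d := by
    rw [Finset.sum_insert (by simp [hab, hac, had]), Finset.sum_insert (by simp [hbc, hbd]),
      Finset.sum_pair hcd]
    ring
  rw [← h]
  refine (Finset.sum_subset (Finset.subset_univ _) fun j _ hj => ?_).symm
  simp only [Finset.mem_insert, Finset.mem_singleton, not_or] at hj
  exact hf j hj.1 hj.2.1 hj.2.2.1 hj.2.2.2

/-- The utility of a NAND-inverter at a nonnegative bundle. -/
lemma IsNandInverter.totalUtil_eq {M : FisherMarket G B} {s a t Hlow : ℝ}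
    {ref gin1 gin2 gout : G} {i : B} (hinv : IsNandInverter M s a t Hlow ref gin1 gin2 gout i)
    {y : G → ℝ} (hy : ∀ j, 0 ≤ y j) :
    M.totalUtil i y = a * min (y gin1) t + a * min (y gin2) t + s * y gout + y ref := by
  obtain ⟨h12, h1o, h2o, h1r, h2r, hor, -, hu1, hu2, huo, hur, hu⟩ := hinv
  rw [FisherMarket.totalUtil, sum_eq_add_four h12 h1o h2o h1r h2r hor
    fun j h1 h2 ho hr => hu j h1 h2 ho hr _ (hy j),
    hu1 _ (hy _), hu2 _ (hy _), huo _ (hy _), hur _ (hy _)]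

/-- If the output good of a NAND-inverter has a better utility-to-price ratio than the reference
good, then any optimal bundle spends on the output good at least the budget left over after buying
`t` units of each input good. -/
lemma IsNandInverter.budget_sub_le_of_isOptimal {M : FisherMarket G B} {s a t Hlow : ℝ}
    {ref gin1 gin2 gout : G} {i : B} (hinv : IsNandInverter M s a t Hlow ref gin1 gin2 gout i)
    {p x : G → ℝ} (hp : ∀ j, 0 ≤ p j) (ht : 0 ≤ t) (hpout : 0 < p gout)
    (hratio : p gout < s * p ref) (hopt : M.IsOptimal p i x) :
    M.budget i - p gin1 * t - p gin2 * t ≤ p gout * x gout := by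
  classical
  obtain ⟨⟨hx0, hxb⟩, hmax⟩ := hopt
  obtain ⟨h12, h1o, h2o, h1r, h2r, hor, -⟩ := id hinv
  have hcost : p gin1 * x gin1 + p gin2 * x gin2 + p gout * x gout + p ref * x ref
      ≤ M.budget i :=
    (add_four_le_sum (f := fun j => p j * x j) (fun j => mul_nonneg (hp j) (hx0 j))
      h12 h1o h2o h1r h2r hor).trans hxb
  have hw1 : p gin1 * min (x gin1) t ≤ p gin1 * x gin1 :=
    mul_le_mul_of_nonneg_left (min_le_left _ _) (hp _)
  have hw2 : p gin2 * min (x gin2) t ≤ p gin2 * x gin2 :=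
    mul_le_mul_of_nonneg_left (min_le_left _ _) (hp _)
  have hwt1 : p gin1 * min (x gin1) t ≤ p gin1 * t :=
    mul_le_mul_of_nonneg_left (min_le_right _ _) (hp _)
  have hwt2 : p gin2 * min (x gin2) t ≤ p gin2 * t :=
    mul_le_mul_of_nonneg_left (min_le_right _ _) (hp _)
  have hwr : 0 ≤ p ref * x ref := mul_nonneg (hp _) (hx0 _)
  have hwo : 0 ≤ p gout * x gout := mul_nonneg (hp _) (hx0 _)
  set z := (M.budget i - p gin1 * min (x gin1) t - p gin2 * min (x gin2) t) / p gout with hz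
  have hpz : p gout * z = M.budget i - p gin1 * min (x gin1) t - p gin2 * min (x gin2) t := by
    rw [hz]; field_simp
  have hz0 : 0 ≤ z := div_nonneg (by linarith) hpout.le
  set y : G → ℝ := fun j => if j = gin1 then min (x gin1) t else if j = gin2 then min (x gin2) t
    else if j = gout then z else 0 with hy
  have hy1 : y gin1 = min (x gin1) t := by simp [hy]
  have hy2 : y gin2 = min (x gin2) t := by simp [hy, h12.symm]
  have hyo : y gout = z := by simp [hy, h1o.symm, h2o.symm]
  have hyr : y ref = 0 := by simp [hy, h1r.symm, h2r.symm, hor.symm]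
  have hy0 : ∀ j, 0 ≤ y j := by
    intro j
    simp only [hy]
    split_ifs
    exacts [le_min (hx0 _) ht, le_min (hx0 _) ht, hz0, le_rfl]
  have hyb : ∑ j, p j * y j = M.budget i := by
    rw [sum_eq_add_four h12 h1o h2o h1r h2r hor
      fun j h1 h2 ho _ => by simp [hy, h1, h2, ho], hy1, hy2, hyo, hyr, hpz]
    ring
  have hle := hmax y ⟨hy0, hyb.le⟩
  rw [hinv.totalUtil_eq hy0, hinv.totalUtil_eq hx0, hy1, hy2, hyo, hyr,
    min_eq_left (min_le_right (x gin1) t), min_eq_left (min_le_right (x gin2) t)] at hle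
  have hgain : s * (z - x gout) ≤ x ref := by linarith
  have hsave : p ref * x ref ≤ p gout * (z - x gout) := by linarith
  have hscaled : s * p ref * (z - x gout) ≤ p gout * (z - x gout) := by
    nlinarith [mul_le_mul_of_nonneg_left hgain (hp ref)]
  have hzx : z ≤ x gout := by
    by_contra! h
    exact absurd hscaled (not_le.2 (mul_lt_mul_of_pos_right hratio (sub_pos.2 h)))
  linarith [mul_le_mul_of_nonneg_left hzx hpout.le]

/-- a NAND gate one of whose input prices is at most `L = s·H/a`
has output price at least `H`, assuming `t = 4/11`, `r = 2/11`, and that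
buyers other than the inverter get at least `2t̄ + r` units of the output
good, where `t̄ = t - 5/k`. -/
theorem stmt_14 {G B : Type} [Fintype G] [Fintype B] [DecidableEq B]
    (M : FisherMarket G B) (ε : ℝ) (hε0 : 0 ≤ ε) (hε1 : ε < 1 / 11)
    (p : G → ℝ) (x : B → G → ℝ) (heq : M.IsApproxEquilibrium ε p x)
    (s a t k H Hlow Hhigh : ℝ)
    (hs : 0 < s) (hsa : s < a) (ha : 1 ≤ a)
    (ht0 : 0 < t) (ht2 : t ≤ 1 / 2)
    (hk : 110 < k) (hsk : s ≤ 1 / (20 * k))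
    (hHlow0 : 0 < Hlow) (hHlowH : Hlow ≤ H) (hHhigh : H ≤ Hhigh)
    (hratio : 1 - 4 / k ≤ Hlow / Hhigh)
    (ref : G) (href : p ref = H / s)
    (ht411 : t = 4 / 11)
    (gin1 gin2 gout : G) (i : B)
    (hinv : IsNandInverter M s a t Hlow ref gin1 gin2 gout i)
    (hpin1 : 0 < p gin1) (hpin1H : p gin1 ≤ H)
    (hpin2 : 0 < p gin2) (hpin2H : p gin2 ≤ H)
    (hminL : min (p gin1) (p gin2) ≤ s * H / a)
    (hpout : 0 < p gout)
    (hsum : 2 * (t - 5 / k) + 2 / 11 ≤ ∑ i' ∈ Finset.univ.erase i, x i' gout) :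
    H ≤ p gout := by
  by_contra! hlt
  obtain ⟨hp, hopt, hclear⟩ := heq
  have hH : 0 < H := hHlow0.trans_le hHlowH
  have hk0 : 0 < k := by linarith
  have hspend := hinv.budget_sub_le_of_isOptimal hp ht0.le hpout
    (by rw [href, mul_div_cancel₀ _ hs.ne']; exact hlt) (hopt i)
  have hbudget : M.budget i = 2 * t * Hlow := hinv.2.2.2.2.2.2.1
  have hxout : x i gout + ∑ i' ∈ Finset.univ.erase i, x i' gout ≤ 1 + ε := by
    rw [Finset.add_sum_erase _ (fun i' => x i' gout) (Finset.mem_univ i)]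
    linarith [(abs_le.1 (hclear gout)).2]
  have hkinv : 1 / k < 1 / 110 := one_div_lt_one_div_of_lt (by norm_num) hk
  rw [show 5 / k = 5 * (1 / k) by ring, ht411] at hsum
  rw [show 4 / k = 4 * (1 / k) by ring, le_div_iff₀ (hH.trans_le hHhigh)] at hratio
  rw [show 1 / (20 * k) = 1 / 20 * (1 / k) by field_simp] at hsk
  have hx311 : x i gout < 3 / 11 := by linarith
  have hlow : (106 / 110) * H ≤ Hlow := by
    nlinarith [mul_le_mul_of_nonneg_right
      (show (106 / 110 : ℝ) ≤ 1 - 4 * (1 / k) by linarith) (hH.le.trans hHhigh)]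
  have hLsmall : s * H / a ≤ (1 / 2200) * H :=
    (div_le_self (by positivity) ha).trans
      (mul_le_mul_of_nonneg_right (by linarith) hH.le)
  have hprices : p gin1 + p gin2 ≤ s * H / a + H := by
    rcases min_le_iff.1 hminL with h | h <;> linarith
  have hcost : p gout * x i gout ≤ H * (3 / 11) :=
    mul_le_mul hlt.le hx311.le ((hopt i).1.1 gout) hH.le
  rw [hbudget, ht411] at hspend
  linarith
end

section
/- Let t, t̄, r, r', ε, L, H, H_low, H_high, p_in, p_mid, p_out be real numbers with t > 0, 0 ≤ t̄ ≤ t, ε ≥ 0, 0 ≤ L, 0 < H, H_low ≤ H ≤ H_high, 1 − 2t − r − ε > 0, and 1 − 2t − r' − ε > 0. Set A := (1 − 2t − r − ε)/t and B' := (1 − 2t̄ − r' + ε)/t, and assume B' ≤ H_low/H_high − L/H. Suppose p_mid ≤ max( L, (H_low − p_in)·t/(1 − 2t − r − ε) ) and p_out ≥ min( H, (H_low − p_mid)·t/(1 − 2t̄ − r' + ε) ). Then for every P ∈ [L, H]: if p_in ≥ H_low·(1 − A) + P·A·B', then p_out ≥ P. -/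
/-- composing an upper bound for a NOT gadget `NOT(in, mid, r)`
with a lower bound for a NOT gadget `NOT(mid, out, r')`: if
`p_in ≥ H_low·(1 − A) + P·A·B'` for `P ∈ [L, H]`, then `p_out ≥ P`. -/
theorem stmt_15 (t tbar r r' ε L H Hlow Hhigh pin pmid pout A B' : ℝ)
    (ht : 0 < t) (htbar0 : 0 ≤ tbar) (htbar : tbar ≤ t) (hε : 0 ≤ ε)
    (hL0 : 0 ≤ L) (hH0 : 0 < H) (hHlowH : Hlow ≤ H) (hHHhigh : H ≤ Hhigh)
    (hr : 0 < 1 - 2 * t - r - ε) (hr' : 0 < 1 - 2 * t - r' - ε)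
    (hA : A = (1 - 2 * t - r - ε) / t)
    (hB' : B' = (1 - 2 * tbar - r' + ε) / t)
    (hB'bound : B' ≤ Hlow / Hhigh - L / H)
    (hmid : pmid ≤ max L ((Hlow - pin) * t / (1 - 2 * t - r - ε)))
    (hout : min H ((Hlow - pmid) * t / (1 - 2 * tbar - r' + ε)) ≤ pout) :
    ∀ P : ℝ, L ≤ P → P ≤ H →
      Hlow * (1 - A) + P * A * B' ≤ pin → P ≤ pout := by
  intro P _ hPH hpin
  have hd : 0 < 1 - 2 * tbar - r' + ε := by linarith
  have hApos : 0 < A := hA ▸ div_pos hr ht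
  have hBpos : 0 < B' := hB' ▸ div_pos hd ht
  have hHhigh : 0 < Hhigh := hH0.trans_le hHHhigh
  have hratio : 0 < Hlow / Hhigh := by
    have := div_nonneg hL0 hH0.le
    linarith
  have hHlow : 0 < Hlow := by
    have := mul_pos hratio hHhigh
    rwa [div_mul_cancel₀ _ hHhigh.ne'] at this
  have hPB : P * B' ≤ Hlow - L := calc
    P * B' ≤ H * (Hlow / Hhigh - L / H) :=
      mul_le_mul hPH hB'bound hBpos.le hH0.le
    _ = H * (Hlow / Hhigh) - L := by field_simp
    _ ≤ Hhigh * (Hlow / Hhigh) - L := by gcongr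
    _ = Hlow - L := by rw [mul_div_cancel₀ _ hHhigh.ne']
  have hAt : A * t = 1 - 2 * t - r - ε := by rw [hA, div_mul_cancel₀ _ ht.ne']
  have hBt : B' * t = 1 - 2 * tbar - r' + ε := by rw [hB', div_mul_cancel₀ _ ht.ne']
  rw [← hAt, mul_div_mul_right _ _ ht.ne'] at hmid
  rw [← hBt, mul_div_mul_right _ _ ht.ne'] at hout
  have hpmid : pmid ≤ Hlow - P * B' := by
    refine hmid.trans (max_le (by linarith) ?_)
    rw [div_le_iff₀ hApos]
    linarith
  refine (le_min hPH ?_).trans hout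
  rw [le_div_iff₀ hBpos]
  linarith
end

section
/- Let t, t̄, r, r', ε, L, H, H_low, p_in, p_mid, p_out be real numbers with t > 0, 0 ≤ t̄ ≤ t, ε ≥ 0, 0 ≤ L ≤ H, H_low ≤ H, 1 − 2t − r − ε > 0, and 1 − 2t − r' − ε > 0. Set A' := (1 − 2t − r' − ε)/t and B := (1 − 2t̄ − r + ε)/t. Suppose p_mid ≥ min( H, (H_low − p_in)·t/(1 − 2t̄ − r + ε) ) and p_out ≤ max( L, (H_low − p_mid)·t/(1 − 2t − r' − ε) ). Then for every P ∈ [L, H]: if p_in ≤ H_low·(1 − B) + P·A'·B, then p_out ≤ P. -/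
/-- composing a lower bound for a NOT gadget `NOT(in, mid, r)`
with an upper bound for a NOT gadget `NOT(mid, out, r')`: if
`p_in ≤ H_low·(1 − B) + P·A'·B` for `P ∈ [L, H]`, then `p_out ≤ P`. -/
theorem stmt_16 (t tbar r r' ε L H Hlow pin pmid pout A' B : ℝ)
    (ht : 0 < t) (htbar0 : 0 ≤ tbar) (htbar : tbar ≤ t) (hε : 0 ≤ ε)
    (hL0 : 0 ≤ L) (hLH : L ≤ H) (hHlowH : Hlow ≤ H)
    (hr : 0 < 1 - 2 * t - r - ε) (hr' : 0 < 1 - 2 * t - r' - ε)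
    (hA' : A' = (1 - 2 * t - r' - ε) / t)
    (hB : B = (1 - 2 * tbar - r + ε) / t)
    (hmid : min H ((Hlow - pin) * t / (1 - 2 * tbar - r + ε)) ≤ pmid)
    (hout : pout ≤ max L ((Hlow - pmid) * t / (1 - 2 * t - r' - ε))) :
    ∀ P : ℝ, L ≤ P → P ≤ H →
      pin ≤ Hlow * (1 - B) + P * A' * B → pout ≤ P := by
  intro P hLP _ hpin
  have hD : 0 < 1 - 2 * tbar - r + ε := by linarith
  have hA'_pos : 0 < A' := hA' ▸ div_pos hr' ht
  have hB_pos : 0 < B := hB ▸ div_pos hD ht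
  have hP : 0 ≤ P := hL0.trans hLP
  have hmid_eq : (Hlow - pin) * t / (1 - 2 * tbar - r + ε) = (Hlow - pin) / B := by
    rw [hB, div_div_eq_mul_div]
  have hout_eq : (Hlow - pmid) * t / (1 - 2 * t - r' - ε) = (Hlow - pmid) / A' := by
    rw [hA', div_div_eq_mul_div]
  rw [hmid_eq] at hmid
  rw [hout_eq] at hout
  have hpmid : Hlow - P * A' ≤ pmid := by
    refine le_trans (le_min ?_ ?_) hmid
    · linarith [mul_nonneg hP hA'_pos.le]
    · rw [le_div_iff₀ hB_pos]
      linarith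
  refine hout.trans (max_le hLP ?_)
  rw [div_le_iff₀ hA'_pos]
  linarith
end

section
/- Let L, H, H_low, A, B', A', B be real numbers with 0 ≤ L ≤ H, 0 < H_low ≤ H, A, B', A', B all in the open interval (0, 1), L ≤ H_low·(1 − A)/(1 − A·B'), and L ≤ H_low·(1 − B)/(1 − A'·B). Let m ≥ 1 be an integer and let q_0, q_1, …, q_m be real numbers. (i) Suppose that for every w ∈ {1, …, m} and every P ∈ [L, H] the implication ( q_{w−1} ≥ H_low·(1 − A) + P·A·B' ⟹ q_w ≥ P ) holds. If q_0 ≥ H_low·(1 − A)/(1 − A·B') + (A·B')^m·( H − H_low·(1 − A)/(1 − A·B') ), then q_m ≥ H. (ii) Suppose that for every w ∈ {1, …, m} and every P ∈ [L, H] the implication ( q_{w−1} ≤ H_low·(1 − B) + P·A'·B ⟹ q_w ≤ P ) holds. If q_0 ≤ H_low·(1 − B)/(1 − A'·B) + (A'·B)^m·( L − H_low·(1 − B)/(1 − A'·B) ), then q_m ≤ L. -/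
/-- If each step pulls a lower bound `P` in `[lo, hi]` back along the affine contraction
`P ↦ F * (1 - c) + P * c` with fixed point `F`, then a lower bound `E` on the last term is
implied by the iterated pullback of `E` bounding the initial term. -/
theorem le_of_affine_chain {lo hi c F E : ℝ} (hc0 : 0 ≤ c) (hc1 : c ≤ 1)
    (hF : F ∈ Set.Icc lo hi) (hE : E ∈ Set.Icc lo hi) (m : ℕ) (q : ℕ → ℝ)
    (step : ∀ w < m, ∀ P ∈ Set.Icc lo hi, F * (1 - c) + P * c ≤ q w → P ≤ q (w + 1))
    (h0 : F + c ^ m * (E - F) ≤ q 0) : E ≤ q m := by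
  induction m generalizing q with
  | zero => simpa using h0
  | succ m ih =>
    refine ih (fun w => q (w + 1)) (fun w hw => step (w + 1) (by omega)) ?_
    refine step 0 (by omega) _ ?_ ?_
    · have hmem := (convex_Icc lo hi).add_smul_sub_mem hF hE
        ⟨pow_nonneg hc0 m, pow_le_one₀ hc0 hc1⟩
      simpa only [smul_eq_mul] using hmem
    · rw [pow_succ] at h0
      linarith

theorem mul_one_sub_div_one_sub_mul_le {h a b : ℝ} (hh : 0 ≤ h) (ha0 : 0 ≤ a) (hb1 : b ≤ 1)
    (hab : a * b < 1) : h * (1 - a) / (1 - a * b) ≤ h := by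
  rw [div_le_iff₀ (by linarith)]
  gcongr
  nlinarith


/-- chaining the two-gate composition bounds through `m` pairs
of NOT gadgets (garbage-region bounds for a chain). -/
theorem stmt_17 (L H Hlow A B' A' B : ℝ)
    (hL0 : 0 ≤ L) (hLH : L ≤ H) (hHlow0 : 0 < Hlow) (hHlowH : Hlow ≤ H)
    (hA : A ∈ Set.Ioo (0 : ℝ) 1) (hB' : B' ∈ Set.Ioo (0 : ℝ) 1)
    (hA' : A' ∈ Set.Ioo (0 : ℝ) 1) (hB : B ∈ Set.Ioo (0 : ℝ) 1)
    (hfix1 : L ≤ Hlow * (1 - A) / (1 - A * B'))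
    (hfix2 : L ≤ Hlow * (1 - B) / (1 - A' * B))
    (m : ℕ) (hm : 1 ≤ m) (q : ℕ → ℝ) :
    ((∀ w, 1 ≤ w → w ≤ m → ∀ P : ℝ, L ≤ P → P ≤ H →
        Hlow * (1 - A) + P * A * B' ≤ q (w - 1) → P ≤ q w) →
      Hlow * (1 - A) / (1 - A * B') +
          (A * B') ^ m * (H - Hlow * (1 - A) / (1 - A * B')) ≤ q 0 →
      H ≤ q m) ∧
    ((∀ w, 1 ≤ w → w ≤ m → ∀ P : ℝ, L ≤ P → P ≤ H →
        q (w - 1) ≤ Hlow * (1 - B) + P * A' * B → q w ≤ P) →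
      q 0 ≤ Hlow * (1 - B) / (1 - A' * B) +
          (A' * B) ^ m * (L - Hlow * (1 - B) / (1 - A' * B)) →
      q m ≤ L) := by
  obtain ⟨hA0, hA1⟩ := hA
  obtain ⟨hB'0, hB'1⟩ := hB'
  obtain ⟨hA'0, hA'1⟩ := hA'
  obtain ⟨hB0, hB1⟩ := hB
  have hc : A * B' < 1 := mul_lt_one_of_nonneg_of_lt_one_left hA0.le hA1 hB'1.le
  have hd : A' * B < 1 := mul_lt_one_of_nonneg_of_lt_one_left hA'0.le hA'1 hB1.le
  have hF := mul_one_sub_div_one_sub_mul_le hHlow0.le hA0.le hB'1.le hc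
  have hG : Hlow * (1 - B) / (1 - A' * B) ≤ Hlow := by
    have := mul_one_sub_div_one_sub_mul_le hHlow0.le hB0.le hA'1.le (by rwa [mul_comm])
    rwa [mul_comm B A'] at this
  have hFfix : Hlow * (1 - A) / (1 - A * B') * (1 - A * B') = Hlow * (1 - A) :=
    div_mul_cancel₀ _ (by linarith)
  have hGfix : Hlow * (1 - B) / (1 - A' * B) * (1 - A' * B) = Hlow * (1 - B) :=
    div_mul_cancel₀ _ (by linarith)
  generalize Hlow * (1 - A) / (1 - A * B') = F at *
  generalize Hlow * (1 - B) / (1 - A' * B) = G at *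
  constructor
  · intro step h0
    refine le_of_affine_chain (by positivity) hc.le ⟨hfix1, hF.trans hHlowH⟩ ⟨hLH, le_rfl⟩ m q
      (fun w hw P hP h => step (w + 1) (by omega) (by omega) P hP.1 hP.2 ?_) h0
    rw [Nat.add_sub_cancel]
    linarith
  · intro step h0
    have hneg : -L ≤ -q m := by
      refine le_of_affine_chain (lo := -H) (hi := -L) (c := A' * B) (F := -G) (by positivity)
        hd.le ⟨by linarith, by linarith⟩ ⟨by linarith, le_rfl⟩ m (fun w => -q w)
        (fun w hw P hP h => ?_) (by linarith)
      have hq := step (w + 1) (by omega) (by omega) (-P) (by linarith [hP.2])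
        (by linarith [hP.1]) (by rw [Nat.add_sub_cancel]; linarith)
      linarith
    linarith
end

section
/- Let 0 ≤ ε < 1/11, set δ := (11/4)·(1/11 − ε) and t := 4/11, let t̄ be a real with t − δ/22 ≤ t̄ ≤ t, and let d be an even integer with d ≥ 2·⌈log₂(3/δ)⌉. Let L, H, H_low be reals with H > 0, 0 ≤ L ≤ δ·H/4, and H/2 ≤ H_low ≤ H. Define A₁ := (1 − 2t − ε)/t, B₁ := (1 − 2t̄ + ε)/t, A'₁ := (1 − 2t − 2/11 − ε)/t, B'₁ := (1 − 2t̄ − 2/11 + ε)/t, and A₂ := A'₁, B₂ := B'₁, A'₂ := A₁, B'₂ := B₁. For i ∈ {1, 2} define R^U_i := H_low·(1 − A_i)/(1 − A_i·B'_i) + (A_i·B'_i)^{d/2}·( H − H_low·(1 − A_i)/(1 − A_i·B'_i) ) and R^L_i := H_low·(1 − B_i)/(1 − A'_i·B_i) + (A'_i·B_i)^{d/2}·( L − H_low·(1 − B_i)/(1 − A'_i·B_i) ). Let p_in, p_out1, p_out2 be reals such that for each i ∈ {1, 2} the implications ( p_in ≥ R^U_i ⟹ p_outi ≥ H ) and (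 p_in ≤ R^L_i ⟹ p_outi ≤ L ) hold. Then: (i) if p_in ≥ H then p_out1 ≥ H and p_out2 ≥ H; (ii) if p_in ≤ L then p_out1 ≤ L and p_out2 ≤ L; (iii) if L < p_in < H then at least one of p_out1, p_out2 lies outside the open interval (L, H). -/
/-- If `k ≥ log₂ (3 / δ)` then `2⁻ᵏ ≤ δ / 3`, hence so is `q ^ k` for `0 ≤ q ≤ 1 / 2`. -/
theorem pow_le_third_of_ceil_logb_le {δ q : ℝ} {k : ℕ} (hδ : 0 < δ)
    (hk : ⌈Real.logb 2 (3 / δ)⌉₊ ≤ k) (hq0 : 0 ≤ q) (hq : q ≤ 1 / 2) : q ^ k ≤ δ / 3 := by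
  have h2 : 3 / δ ≤ (2 : ℝ) ^ k := by
    have h := (Real.logb_le_iff_le_rpow one_lt_two (by positivity)).1 (Nat.ceil_le.1 hk)
    rwa [Real.rpow_natCast] at h
  calc q ^ k ≤ (1 / 2) ^ k := pow_le_pow_left₀ hq0 hq k
    _ = 1 / 2 ^ k := by rw [div_pow, one_pow]
    _ ≤ 1 / (3 / δ) := one_div_le_one_div_of_le (by positivity) h2
    _ = δ / 3 := one_div_div _ _

/-- The upper chain bound never exceeds `H`. -/
theorem chain_upper_le {a b w h H : ℝ} (ha0 : 0 ≤ a) (hb1 : b ≤ 1)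
    (hab : a * b < 1) (hw1 : w ≤ 1) (hh0 : 0 ≤ h) (hhH : h ≤ H) :
    h * (1 - a) / (1 - a * b) + w * (H - h * (1 - a) / (1 - a * b)) ≤ H := by
  have hfix : h * (1 - a) / (1 - a * b) ≤ H := by
    refine le_trans ?_ hhH
    rw [div_le_iff₀ (by linarith)]
    exact mul_le_mul_of_nonneg_left (by nlinarith) hh0
  nlinarith

/-- The lower chain bound is at least `L` when `L ≤ h * (1 - b)`. -/
theorem le_chain_lower {q b w h L : ℝ} (hq0 : 0 ≤ q) (hq1 : q < 1) (hw1 : w ≤ 1)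
    (hL0 : 0 ≤ L) (hL : L ≤ h * (1 - b)) :
    L ≤ h * (1 - b) / (1 - q) + w * (L - h * (1 - b) / (1 - q)) := by
  have hfix : L ≤ h * (1 - b) / (1 - q) := by
    rw [le_div_iff₀ (by linarith)]
    nlinarith
  nlinarith

/-- correctness of the PURIFY gate built from two chains of `d`
NOT gadgets: on a pure input both outputs copy the input bit, and on a `⊥`
input (price strictly between `L` and `H`) at least one output is pure. -/
theorem stmt_18 (ε δ t tbar : ℝ) (d : ℕ) (L H Hlow : ℝ)
    (A1 B1 A1' B1' A2 B2 A2' B2' RU1 RL1 RU2 RL2 pin pout1 pout2 : ℝ)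
    (hε0 : 0 ≤ ε) (hε1 : ε < 1 / 11)
    (hδ : δ = 11 / 4 * (1 / 11 - ε)) (ht : t = 4 / 11)
    (htbar1 : t - δ / 22 ≤ tbar) (htbar2 : tbar ≤ t)
    (hdeven : Even d) (hd : 2 * ⌈Real.logb 2 (3 / δ)⌉₊ ≤ d)
    (hH0 : 0 < H) (hL0 : 0 ≤ L) (hLδ : L ≤ δ * H / 4)
    (hHlow1 : H / 2 ≤ Hlow) (hHlow2 : Hlow ≤ H)
    (hA1 : A1 = (1 - 2 * t - ε) / t)
    (hB1 : B1 = (1 - 2 * tbar + ε) / t)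
    (hA1' : A1' = (1 - 2 * t - 2 / 11 - ε) / t)
    (hB1' : B1' = (1 - 2 * tbar - 2 / 11 + ε) / t)
    (hA2 : A2 = A1') (hB2 : B2 = B1') (hA2' : A2' = A1) (hB2' : B2' = B1)
    (hRU1 : RU1 = Hlow * (1 - A1) / (1 - A1 * B1') +
        (A1 * B1') ^ (d / 2) * (H - Hlow * (1 - A1) / (1 - A1 * B1')))
    (hRL1 : RL1 = Hlow * (1 - B1) / (1 - A1' * B1) +
        (A1' * B1) ^ (d / 2) * (L - Hlow * (1 - B1) / (1 - A1' * B1)))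
    (hRU2 : RU2 = Hlow * (1 - A2) / (1 - A2 * B2') +
        (A2 * B2') ^ (d / 2) * (H - Hlow * (1 - A2) / (1 - A2 * B2')))
    (hRL2 : RL2 = Hlow * (1 - B2) / (1 - A2' * B2) +
        (A2' * B2) ^ (d / 2) * (L - Hlow * (1 - B2) / (1 - A2' * B2)))
    (himp1U : RU1 ≤ pin → H ≤ pout1) (himp1L : pin ≤ RL1 → pout1 ≤ L)
    (himp2U : RU2 ≤ pin → H ≤ pout2) (himp2L : pin ≤ RL2 → pout2 ≤ L) :
    (H ≤ pin → H ≤ pout1 ∧ H ≤ pout2) ∧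
    (pin ≤ L → pout1 ≤ L ∧ pout2 ≤ L) ∧
    (L < pin → pin < H → pout1 ∉ Set.Ioo L H ∨ pout2 ∉ Set.Ioo L H) := by
  have hδ0 : 0 < δ := by linarith
  have hδ1 : δ ≤ 1 / 4 := by linarith
  have hk : ⌈Real.logb 2 (3 / δ)⌉₊ ≤ d / 2 := by omega
  have ha : A1 = 1 / 2 + δ := by rw [hA1, ht, hδ]; ring
  have ha' : A1' = δ := by rw [hA1', ht, hδ]; ring
  have hb' : B1' = B1 - 1 / 2 := by rw [hB1', hB1, ht]; ring
  have hb : B1 = 3 - δ - 11 / 2 * tbar := by rw [hB1, ht, hδ]; ring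
  have hb0 : 1 - δ ≤ B1 := by linarith
  have hb1 : B1 ≤ 1 - 3 / 4 * δ := by linarith
  have hδH : 0 < δ * H := mul_pos hδ0 hH0
  have hlow : 3 / 8 * (δ * H) ≤ Hlow * (1 - B1) := by
    have h := mul_le_mul hHlow1 (show 3 / 4 * δ ≤ 1 - B1 by linarith) (by positivity)
      (by linarith)
    linarith only [h]
  rw [hA2, hB2'] at hRU2
  rw [hA2', hB2] at hRL2
  clear hA1 hB1 hA1' hB1' hA2 hB2 hA2' hB2' ht htbar1 htbar2 hb hε0 hε1 hδ hd hdeven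
  have hq0 : 0 ≤ A1 * B1' := by rw [ha, hb']; apply mul_nonneg <;> linarith
  have hq : A1 * B1' ≤ 1 / 2 := by rw [ha, hb']; nlinarith only [hδ0, hδ1, hb0, hb1]
  have hr0 : 0 ≤ A1' * B1 := by rw [ha']; apply mul_nonneg <;> linarith
  have hr : A1' * B1 ≤ 1 / 2 := by rw [ha']; nlinarith only [hδ0, hδ1, hb0, hb1]
  have hqk := pow_le_third_of_ceil_logb_le hδ0 hk hq0 hq
  have hrk := pow_le_third_of_ceil_logb_le hδ0 hk hr0 hr
  have hU1 : RU1 ≤ H := by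
    rw [hRU1]
    exact chain_upper_le (by linarith) (by linarith) (by linarith) (by linarith) (by linarith) hHlow2
  have hU2 : RU2 ≤ H := by
    rw [hRU2]
    exact chain_upper_le (by linarith) (by linarith) (by linarith) (by linarith) (by linarith) hHlow2
  have hL1 : L ≤ RL1 := by
    rw [hRL1]
    exact le_chain_lower hr0 (by linarith only [hr]) (by linarith only [hrk, hδ1]) hL0
      (by linarith only [hLδ, hlow, hδH])
  have hL2 : L ≤ RL2 := by
    rw [hRL2]
    exact le_chain_lower hq0 (by linarith only [hq]) (by linarith only [hqk, hδ1]) hL0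
      (by rw [hb']; linarith only [hLδ, hlow, hδH, hHlow1, hH0])
  have hcross : RU1 ≤ RL2 := by
    have hgap : 7 / 8 * (δ * H) ≤
        Hlow * (1 - B1') / (1 - A1 * B1') - Hlow * (1 - A1) / (1 - A1 * B1') := by
      rw [← sub_div, le_div_iff₀ (by linarith)]
      have h1 : 7 / 8 * (δ * H) ≤ Hlow * (1 - B1') - Hlow * (1 - A1) := by
        rw [ha, hb']
        have h3 := mul_le_mul_of_nonneg_right hHlow1 hδ0.le
        linarith only [hlow, h3]
      have h2 : 0 ≤ δ * H * (A1 * B1') := by positivity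
      linarith
    rw [hRU1, hRL2]
    have hw0 : 0 ≤ (A1 * B1') ^ (d / 2) := pow_nonneg hq0 _
    generalize (A1 * B1') ^ (d / 2) = w at *
    generalize Hlow * (1 - B1') / (1 - A1 * B1') = y at *
    generalize Hlow * (1 - A1) / (1 - A1 * B1') = x at *
    have hwH : w * H ≤ δ / 3 * H := mul_le_mul_of_nonneg_right hqk hH0.le
    have hwL : 0 ≤ w * L := mul_nonneg hw0 hL0
    have hwg : w * (y - x) ≤ 1 / 12 * (y - x) :=
      mul_le_mul_of_nonneg_right (by linarith) (by linarith)
    linarith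
  refine ⟨fun h => ⟨himp1U (hU1.trans h), himp2U (hU2.trans h)⟩,
    fun h => ⟨himp1L (h.trans hL1), himp2L (h.trans hL2)⟩, fun _ _ => ?_⟩
  rcases le_total RU1 pin with h | h
  · exact Or.inl fun hm => hm.2.not_ge (himp1U h)
  · exact Or.inr fun hm => hm.1.not_ge (himp2L (h.trans hcross))
end
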